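/- arXiv:2308.01461 — 11 statements merged into one kernel-verified Lean document; each statement's English description precedes it below -/
import Mathlib

section
/- Let G_1, G_2, G_3 be three directed graphs on a common set of n vertices. If e(G_i) + e(G_j) > ((104 − 8√7)/81)·n^2 + 3n for every pair 1 ≤ i < j ≤ 3, then there exists a rainbow transitive triangle. -/
/-- The real-valued indicator of a proposition. -/
noncomputable def ind (P : Prop) : ℝ := by
  classical exact if P then 1 else 0

lemma ind_true {P : Prop} (h : P) : ind P = 1 := by simp [ind, h]

lemma ind_false {P : Prop} (h : ¬P) : ind P = 0 := by simp [ind, h]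

lemma ind_nonneg (P : Prop) : 0 ≤ ind P := by
  by_cases h : P <;> simp [ind, h]

lemma ind_le_one (P : Prop) : ind P ≤ 1 := by
  by_cases h : P <;> simp [ind, h]

/-- `σ` restricts to an involution of `A ⊆ S` that moves every vertex along a `P`-edge. -/
def IsMatch {V : Type*} (P : V → V → Prop) (S A : Finset V) (σ : V → V) : Prop :=
  A ⊆ S ∧ ∀ v ∈ A, σ v ∈ A ∧ σ (σ v) = v ∧ P v (σ v)

section Matching

variable {V : Type*} {P : V → V → Prop} {S A : Finset V} {σ : V → V}

lemma exists_max_match (P : V → V → Prop) (S : Finset V) :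
    ∃ A σ, IsMatch P S A σ ∧ ∀ A' σ', IsMatch P S A' σ' → A'.card ≤ A.card := by
  classical
  have hne : (S.powerset.filter fun A => ∃ σ, IsMatch P S A σ).Nonempty :=
    ⟨∅, Finset.mem_filter.2 ⟨by simp, id, by simp [IsMatch]⟩⟩
  obtain ⟨A, hA, hmax⟩ := Finset.exists_max_image _ Finset.card hne
  simp only [Finset.mem_filter, Finset.mem_powerset] at hA hmax
  obtain ⟨-, σ, hσ⟩ := hA
  exact ⟨A, σ, hσ, fun T ρ h => hmax T ⟨h.1, ρ, h⟩⟩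

/-- A maximum matching leaves no edge uncovered. -/
lemma not_edge_of_max (hP : ∀ u v, P u v → P v u) (hm : IsMatch P S A σ)
    (hmax : ∀ A' σ', IsMatch P S A' σ' → A'.card ≤ A.card) {w w' : V}
    (hw : w ∈ S) (hw' : w' ∈ S) (hwA : w ∉ A) (hwA' : w' ∉ A) (hne : w ≠ w') : ¬P w w' := by
  classical
  intro h
  have := hmax (insert w (insert w' A)) (Function.update (Function.update σ w w') w' w) (by
    refine ⟨?_, ?_⟩
    · intro x hx
      have := @hm.1 x
      grind
    · intro v hv
      have := hm.2 v
      have := hP w w' h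
      grind [Function.update_apply])
  rw [Finset.card_insert_of_notMem (by grind), Finset.card_insert_of_notMem (by grind)] at this
  omega

/-- A maximum matching admits no augmenting path of length three. -/
lemma not_augment_of_max (hP : ∀ u v, P u v → P v u) (hm : IsMatch P S A σ)
    (hmax : ∀ A' σ', IsMatch P S A' σ' → A'.card ≤ A.card) {v w w' : V} (hv : v ∈ A)
    (hw : w ∈ S) (hw' : w' ∈ S) (hwA : w ∉ A) (hwA' : w' ∉ A)
    (h : P v w) (h' : P (σ v) w') : w = w' := by
  classical
  by_contra hne
  have h1 := hm.2 v hv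
  by_cases hvv : σ v = v
  · rw [hvv] at h'
    have := hmax (insert w A) (Function.update (Function.update σ v w) w v) (by
      refine ⟨?_, ?_⟩
      · intro x hx
        have := @hm.1 x
        grind
      · intro x hx
        have := hm.2 x
        have := hP _ _ h
        grind [Function.update_apply])
    rw [Finset.card_insert_of_notMem (by grind)] at this
    omega
  · have hvw : v ≠ w := fun e => hwA (e ▸ hv)
    have hvw' : v ≠ w' := fun e => hwA' (e ▸ hv)
    have hsw : σ v ≠ w := fun e => hwA (e ▸ h1.1)
    have hsw' : σ v ≠ w' := fun e => hwA' (e ▸ h1.1)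
    have := hmax (insert w (insert w' A)) (fun x => if x = v then w else if x = w then v else
      if x = σ v then w' else if x = w' then σ v else σ x) (by
      refine ⟨?_, ?_⟩
      · intro x hx
        have := @hm.1 x
        grind
      · intro x hx
        by_cases e1 : x = v
        · subst e1
          simp [hvw.symm, h]
        by_cases e2 : x = w
        · subst e2
          simp [hvw.symm, hv, hP _ _ h]
        by_cases e3 : x = σ v
        · subst e3
          simp [hvv, hsw, h', hvw'.symm, Ne.symm hne, hsw'.symm]
        by_cases e4 : x = w'
        · subst e4
          simp [hvw'.symm, Ne.symm hne, hsw'.symm, hvv, hsw, h1.1, hP _ _ h']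
        have hx' : x ∈ A := by simpa [e2, e4] using hx
        obtain ⟨m1, m2, m3⟩ := hm.2 x hx'
        have f1 : σ x ≠ v := fun e => e3 (by rw [← e, m2])
        have f2 : σ x ≠ w := fun e => hwA (e ▸ m1)
        have f3 : σ x ≠ σ v := fun e => e1 (by rw [← m2, e, h1.2.1])
        have f4 : σ x ≠ w' := fun e => hwA' (e ▸ m1)
        simp [e1, e2, e3, e4, f1, f2, f3, f4, m1, m2, m3])
    rw [Finset.card_insert_of_notMem (by grind), Finset.card_insert_of_notMem (by grind)] at this
    omega

lemma sum_match (hm : IsMatch P S A σ) (f : V → ℝ) : ∑ v ∈ A, f (σ v) = ∑ v ∈ A, f v :=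
  Finset.sum_nbij' σ σ (fun v hv => (hm.2 v hv).1) (fun v hv => (hm.2 v hv).1)
    (fun v hv => (hm.2 v hv).2.1) (fun v hv => (hm.2 v hv).2.1) (fun _ _ => rfl)

lemma sum_le_of_match (hm : IsMatch P S A σ) (f : V → ℝ) (k : ℝ)
    (h : ∀ v ∈ A, f v + f (σ v) ≤ 2 * k) : ∑ v ∈ A, f v ≤ k * A.card := by
  have h1 : ∑ v ∈ A, (f v + f (σ v)) ≤ ∑ _v ∈ A, 2 * k := Finset.sum_le_sum h
  rw [Finset.sum_add_distrib, sum_match hm, Finset.sum_const, nsmul_eq_mul] at h1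
  linarith

lemma sum_sum_le_of_match (hm : IsMatch P S A σ) (T : Finset V) (φ : V → V → ℝ) (k : ℝ)
    (h : ∀ v ∈ A, ∀ w ∈ T, φ v w + φ (σ v) w ≤ 2 * k) :
    ∑ v ∈ A, ∑ w ∈ T, φ v w ≤ k * A.card * T.card := by
  have := sum_le_of_match hm (fun v => ∑ w ∈ T, φ v w) (k * T.card) (fun v hv => by
    rw [← Finset.sum_add_distrib]
    refine (Finset.sum_le_sum (h v hv)).trans ?_
    rw [Finset.sum_const, nsmul_eq_mul]
    linarith)
  linarith

/-- Two sets of which every member of the one equals every member of the other. -/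
lemma sum_ind_add_le {T : Finset V} {X Y : V → Prop} {m : ℝ} (hm : 0 ≤ m)
    (h : ∀ w ∈ T, ∀ w' ∈ T, X w → Y w' → w = w')
    (hX : ∑ w ∈ T, ind (X w) ≤ m) (hY : ∑ w ∈ T, ind (Y w) ≤ m) :
    ∑ w ∈ T, ind (X w) + ∑ w ∈ T, ind (Y w) ≤ m + 1 := by
  classical
  by_cases hx : ∃ w ∈ T, X w
  · obtain ⟨w, hw, hXw⟩ := hx
    have : ∑ w' ∈ T, ind (Y w') ≤ 1 := by
      rw [← Finset.add_sum_erase T _ hw, Finset.sum_eq_zero, add_zero]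
      · exact ind_le_one _
      · intro w' hw'
        rw [Finset.mem_erase] at hw'
        exact ind_false fun hY => hw'.1 (h w hw w' hw'.2 hXw hY).symm
    linarith
  · rw [Finset.sum_eq_zero fun w hw => ind_false fun hXw => hx ⟨w, hw, hXw⟩]
    linarith

lemma sum_ind_mul_le {T : Finset V} {X Y : V → Prop}
    (h : ∀ w ∈ T, ∀ w' ∈ T, X w → Y w' → w = w') :
    ∑ w ∈ T, ind (X w) * ind (Y w) ≤ 1 := by
  classical
  by_cases hx : ∃ w ∈ T, X w
  · obtain ⟨w, hw, hXw⟩ := hx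
    rw [← Finset.add_sum_erase T _ hw, Finset.sum_eq_zero, add_zero]
    · exact mul_le_one₀ (ind_le_one _) (ind_nonneg _) (ind_le_one _)
    · intro w' hw'
      rw [Finset.mem_erase] at hw'
      rw [ind_false (P := Y w') fun hY => hw'.1 (h w hw w' hw'.2 hXw hY).symm, mul_zero]
  · rw [Finset.sum_eq_zero fun w hw => by
      rw [ind_false fun hXw => hx ⟨w, hw, hXw⟩, zero_mul]]
    exact zero_le_one

lemma sum_ind_le_card (T : Finset V) (X : V → Prop) : ∑ w ∈ T, ind (X w) ≤ T.card := by
  refine (Finset.sum_le_sum fun w _ => ind_le_one (X w)).trans ?_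
  simp

lemma sum_sum_ind_le_card (T U : Finset V) (X : V → V → Prop) :
    ∑ v ∈ T, ∑ w ∈ U, ind (X v w) ≤ T.card * U.card := by
  refine (Finset.sum_le_sum fun v _ => sum_ind_le_card U (X v)).trans ?_
  simp

lemma sum_sum_symm (T U : Finset V) {φ : V → V → ℝ} (h : ∀ u v, φ u v = φ v u) :
    ∑ v ∈ T, ∑ w ∈ U, φ v w = ∑ v ∈ U, ∑ w ∈ T, φ v w := by
  rw [Finset.sum_comm]
  simp_rw [h]

/-- In a bipartite graph, twice the number of edges is at most the number of ordered pairs on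
either side with a common neighbour. -/
lemma two_mul_edges_le (C B : Finset V) (θ : V → V → Prop) :
    2 * ∑ v ∈ C, ∑ w ∈ B, ind (θ v w) ≤
      (∑ v ∈ C, ∑ v' ∈ C, ind (∃ w ∈ B, θ v w ∧ θ v' w)) +
        ∑ w ∈ B, ∑ w' ∈ B, ind (∃ v ∈ C, θ v w ∧ θ v w') := by
  have key : ∀ (C B : Finset V) (θ : V → V → Prop),
      ∑ v ∈ C, ∑ w ∈ B, ind (θ v w) * ((∑ v' ∈ C, ind (θ v' w)) / ∑ w' ∈ B, ind (θ v w')) ≤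
        ∑ v ∈ C, ∑ v' ∈ C, ind (∃ w ∈ B, θ v w ∧ θ v' w) := by
    intro C B θ
    refine Finset.sum_le_sum fun v hv => ?_
    set t := ∑ w' ∈ B, ind (θ v w') with ht
    set L := ∑ v' ∈ C, ind (∃ w ∈ B, θ v w ∧ θ v' w) with hL
    have hL0 : 0 ≤ L := Finset.sum_nonneg fun _ _ => ind_nonneg _
    have ht0 : 0 ≤ t := Finset.sum_nonneg fun _ _ => ind_nonneg _
    rcases ht0.eq_or_lt with h0 | h0
    · simp [← h0, hL0]
    · have : ∑ w ∈ B, ind (θ v w) * ((∑ v' ∈ C, ind (θ v' w)) / t)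
          ≤ ∑ w ∈ B, ind (θ v w) * (L / t) := by
        refine Finset.sum_le_sum fun w hw => ?_
        by_cases h : θ v w
        · rw [ind_true h, one_mul, one_mul]
          gcongr
          refine Finset.sum_le_sum fun v' _ => ?_
          by_cases h' : θ v' w
          · rw [ind_true h', ind_true ⟨w, hw, h, h'⟩]
          · rw [ind_false h']
            exact ind_nonneg _
        · simp [ind_false h]
      rw [← Finset.sum_mul, ← ht] at this
      rwa [mul_div_cancel₀ _ h0.ne'] at this
  have h1 := key C B θ
  have h2 := key B C fun w v => θ v w
  rw [Finset.sum_comm] at h2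
  refine le_trans ?_ (add_le_add h1 h2)
  rw [← Finset.sum_add_distrib, Finset.mul_sum]
  refine Finset.sum_le_sum fun v hv => ?_
  rw [← Finset.sum_add_distrib, Finset.mul_sum]
  refine Finset.sum_le_sum fun w hw => ?_
  by_cases h : θ v w
  · have hx : 0 < ∑ v' ∈ C, ind (θ v' w) :=
      Finset.sum_pos' (fun _ _ => ind_nonneg _) ⟨v, hv, by simp [ind_true h]⟩
    have hy : 0 < ∑ w' ∈ B, ind (θ v w') :=
      Finset.sum_pos' (fun _ _ => ind_nonneg _) ⟨w, hw, by simp [ind_true h]⟩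
    rw [ind_true h, one_mul, one_mul, mul_one, div_add_div _ _ hy.ne' hx.ne',
      le_div_iff₀ (mul_pos hy hx)]
    nlinarith [sq_nonneg ((∑ v' ∈ C, ind (θ v' w)) - ∑ w' ∈ B, ind (θ v w'))]
  · simp [ind_false h]

end Matching

section TwoType

variable {V : Type*} {p q z : V → V → Prop} {D C B R : Finset V} {ρ : V → V}

/-- Two disjoint symmetric relations `p` and `q`, every path with a `p`-edge and a `q`-edge being
closed by a `z`-pair, on a set `D` with a maximum matching of `p`- and `q`-edges: `C` is covered
by its `p`-edges, `B` by its `q`-edges, and `R` is left uncovered. -/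
structure TwoType (p q z : V → V → Prop) (D C B R : Finset V) (ρ : V → V) : Prop where
  p_symm : ∀ u v, p u v → p v u
  q_symm : ∀ u v, q u v → q v u
  z_symm : ∀ u v, z u v → z v u
  not_q : ∀ u v, p u v → ¬q u v
  not_p_z : ∀ u v, p u v → ¬z u v
  not_q_z : ∀ u v, q u v → ¬z u v
  cherry : ∀ u v w, p u v → q v w → z u w
  match_p : IsMatch p D C ρ
  match_q : IsMatch q D B ρ
  sum_eq : ∀ f : V → ℝ, ∑ v ∈ D, f v = ∑ v ∈ C, f v + ∑ v ∈ B, f v + ∑ v ∈ R, f v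
  not_p_rest : ∀ u ∈ R, ∀ v ∈ R, ¬p u v
  not_q_rest : ∀ u ∈ R, ∀ v ∈ R, ¬q u v
  augment_p : ∀ v ∈ C, ∀ w ∈ R, ∀ w' ∈ R, p v w → p (ρ v) w' → w = w'
  augment_q : ∀ v ∈ B, ∀ w ∈ R, ∀ w' ∈ R, q v w → q (ρ v) w' → w = w'

namespace TwoType

lemma swap (h : TwoType p q z D C B R ρ) : TwoType q p z D B C R ρ where
  p_symm := h.q_symm
  q_symm := h.p_symm
  z_symm := h.z_symm
  not_q := fun u v h1 h2 => h.not_q u v h2 h1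
  not_p_z := h.not_q_z
  not_q_z := h.not_p_z
  cherry := fun u v w h1 h2 => h.z_symm _ _ (h.cherry _ _ _ (h.p_symm _ _ h2) (h.q_symm _ _ h1))
  match_p := h.match_q
  match_q := h.match_p
  sum_eq := fun f => by rw [h.sum_eq]; ring
  not_p_rest := h.not_q_rest
  not_q_rest := h.not_p_rest
  augment_p := h.augment_q
  augment_q := h.augment_p

lemma card_eq (h : TwoType p q z D C B R ρ) : (D.card : ℝ) = C.card + B.card + R.card := by
  simpa using h.sum_eq fun _ => 1

lemma sum_sum_eq (h : TwoType p q z D C B R ρ) {φ : V → V → ℝ} (hφ : ∀ u v, φ u v = φ v u) :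
    ∑ u ∈ D, ∑ v ∈ D, φ u v =
      ∑ u ∈ C, ∑ v ∈ C, φ u v + ∑ u ∈ B, ∑ v ∈ B, φ u v + ∑ u ∈ R, ∑ v ∈ R, φ u v +
        2 * ∑ u ∈ C, ∑ v ∈ B, φ u v + 2 * ∑ u ∈ C, ∑ v ∈ R, φ u v +
        2 * ∑ u ∈ B, ∑ v ∈ R, φ u v := by
  simp_rw [h.sum_eq, Finset.sum_add_distrib]
  rw [sum_sum_symm B C hφ, sum_sum_symm R C hφ, sum_sum_symm R B hφ]
  ring

lemma ind_symm {p : V → V → Prop} (h : ∀ u v, p u v → p v u) (u v : V) :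
    ind (p u v) = ind (p v u) := by
  rw [propext ⟨h u v, h v u⟩]

lemma sum_q_sub_z_le (h : TwoType p q z D C B R ρ) (T : Finset V) :
    ∑ v ∈ C, ∑ w ∈ T, (ind (q v w) - ind (z v w)) ≤ 0 := by
  have := sum_sum_le_of_match h.match_p T (fun v w => ind (q v w) - ind (z v w)) 0
    (fun v hv w _ => by
      have hv' := (h.match_p.2 v hv).2.2
      have hle : ∀ v v', p v v' → ind (q v w) ≤ ind (z v' w) := fun v v' e => by
        by_cases hq : q v w
        · rw [ind_true hq, ind_true (h.cherry _ _ _ (h.p_symm _ _ e) hq)]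
        · rw [ind_false hq]
          exact ind_nonneg _
      have h1 := hle _ _ hv'
      have h2 := hle _ _ (h.p_symm _ _ hv')
      linarith)
  simpa using this

lemma sum_p_rest_le (h : TwoType p q z D C B R ρ) :
    2 * ∑ v ∈ C, ∑ w ∈ R, ind (p v w) ≤ C.card * (R.card + 1) := by
  have := sum_le_of_match h.match_p (fun v => ∑ w ∈ R, ind (p v w)) ((R.card + 1) / 2)
    (fun v hv => by
      have := sum_ind_add_le (Nat.cast_nonneg R.card) (h.augment_p v hv)
        (sum_ind_le_card R _) (sum_ind_le_card R _)
      linarith)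
  linarith

lemma sum_rest_nonpos (h : TwoType p q z D C B R ρ) :
    ∑ u ∈ R, ∑ v ∈ R, (ind (p u v) - ind (z u v)) ≤ 0 :=
  Finset.sum_nonpos fun u hu => Finset.sum_nonpos fun v hv => by
    rw [ind_false (h.not_p_rest u hu v hv)]
    linarith [ind_nonneg (z u v)]

lemma sum_p_sub_z_le (h : TwoType p q z D C B R ρ) :
    ∑ u ∈ D, ∑ v ∈ D, (ind (p u v) - ind (z u v)) ≤ C.card * (D.card - B.card) + C.card := by
  rw [h.sum_sum_eq (fun u v => by rw [ind_symm h.p_symm, ind_symm h.z_symm]), h.card_eq]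
  have hB := h.swap.sum_q_sub_z_le B
  have hC := h.swap.sum_q_sub_z_le C
  have hR := h.swap.sum_q_sub_z_le R
  rw [sum_sum_symm B C (fun u v => by rw [ind_symm h.p_symm, ind_symm h.z_symm])] at hC
  have hCC : ∑ u ∈ C, ∑ v ∈ C, (ind (p u v) - ind (z u v)) ≤ C.card * C.card :=
    le_trans (Finset.sum_le_sum fun u _ => Finset.sum_le_sum fun v _ => by
      linarith [ind_nonneg (z u v)]) (sum_sum_ind_le_card C C p)
  have hCR : ∑ u ∈ C, ∑ v ∈ R, (ind (p u v) - ind (z u v)) ≤ ∑ u ∈ C, ∑ v ∈ R, ind (p u v) :=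
    Finset.sum_le_sum fun u _ => Finset.sum_le_sum fun v _ => by linarith [ind_nonneg (z u v)]
  linarith [h.sum_p_rest_le, h.sum_rest_nonpos]

/-- Sum over the four pairs between a `p`-edge `v (ρ v)` and a `q`-edge `w (ρ w)`. -/
lemma four_sum_le (h : TwoType p q z D C B R ρ) {v v' w w' : V} (hv : p v v') (hw : q w w') :
    (ind (p v w) + ind (q v w) - ind (z v w)) + (ind (p v' w) + ind (q v' w) - ind (z v' w)) +
      (ind (p v w') + ind (q v w') - ind (z v w')) +
      (ind (p v' w') + ind (q v' w') - ind (z v' w')) ≤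
    ind (p v w' ∧ q v' w) + ind (p v' w' ∧ q v w) + ind (p v w ∧ q v' w') +
      ind (p v' w ∧ q v w') := by
  have hv1 := h.p_symm _ _ hv
  have hw1 := h.q_symm _ _ hw
  have a1 := fun e => h.cherry v w w' e hw
  have a2 := fun e => h.cherry v w' w e hw1
  have a3 := fun e => h.cherry v' w w' e hw
  have a4 := fun e => h.cherry v' w' w e hw1
  have b1 := fun e => h.cherry v' v w hv1 e
  have b2 := fun e => h.cherry v' v w' hv1 e
  have b3 := fun e => h.cherry v v' w hv e
  have b4 := fun e => h.cherry v v' w' hv e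
  have c1 := h.not_q v w
  have c2 := h.not_q v w'
  have c3 := h.not_q v' w
  have c4 := h.not_q v' w'
  have d1 := h.not_p_z v w
  have d2 := h.not_p_z v w'
  have d3 := h.not_p_z v' w
  have d4 := h.not_p_z v' w'
  have e1 := h.not_q_z v w
  have e2 := h.not_q_z v w'
  have e3 := h.not_q_z v' w
  have e4 := h.not_q_z v' w'
  clear hv hw hv1 hw1 h
  generalize p v w = x1 at *
  generalize p v w' = x2 at *
  generalize p v' w = x3 at *
  generalize p v' w' = x4 at *
  generalize q v w = y1 at *
  generalize q v w' = y2 at *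
  generalize q v' w = y3 at *
  generalize q v' w' = y4 at *
  generalize z v w = z1 at *
  generalize z v w' = z2 at *
  generalize z v' w = z3 at *
  generalize z v' w' = z4 at *
  by_cases x1 <;> by_cases x2 <;> by_cases x3 <;> by_cases x4 <;> simp_all [ind] <;>
  by_cases y1 <;> by_cases y2 <;> by_cases y3 <;> by_cases y4 <;> simp_all <;>
  by_cases z1 <;> by_cases z2 <;> by_cases z3 <;> by_cases z4 <;> simp_all <;> norm_num

lemma sum_cross_le (h : TwoType p q z D C B R ρ) :
    ∑ v ∈ C, ∑ w ∈ B, (ind (p v w) + ind (q v w) - ind (z v w)) ≤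
      ∑ v ∈ C, ∑ w ∈ B, ind (p v (ρ w) ∧ q (ρ v) w) := by
  set f : V → V → ℝ := fun v w =>
    ind (p v w) + ind (q v w) - ind (z v w) - ind (p v (ρ w) ∧ q (ρ v) w) with hf
  suffices hs : ∑ v ∈ C, ∑ w ∈ B, f v w ≤ 0 by
    simp only [hf, Finset.sum_sub_distrib] at hs ⊢
    linarith
  have := sum_le_of_match h.match_p (fun v => ∑ w ∈ B, f v w) 0 (fun v hv => by
    obtain ⟨-, hv2, hv3⟩ := h.match_p.2 v hv
    have := sum_le_of_match h.match_q (fun w => f v w + f (ρ v) w) 0 (fun w hw => by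
      obtain ⟨-, hw2, hw3⟩ := h.match_q.2 w hw
      have := h.four_sum_le hv3 hw3
      simp only [hf, hv2, hw2]
      linarith)
    rw [Finset.sum_add_distrib] at this
    linarith)
  linarith

lemma sum_p_square_le (h : TwoType p q z D C B R ρ) :
    ∑ v ∈ C, ∑ v' ∈ C, ind (p v v') ≤ C.card * C.card -
      ∑ v ∈ C, ∑ v' ∈ C, ind (∃ w ∈ B, (p v (ρ w) ∧ q (ρ v) w) ∧ p v' (ρ w) ∧ q (ρ v') w) := by
  have h1 : ∑ v ∈ C, ∑ v' ∈ C, ind (p v v') = ∑ v ∈ C, ∑ v' ∈ C, ind (p (ρ v) (ρ v')) := by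
    rw [← sum_match h.match_p]
    exact Finset.sum_congr rfl fun v _ => (sum_match h.match_p fun v' => ind (p (ρ v) v')).symm
  rw [h1, le_sub_iff_add_le, ← Finset.sum_add_distrib]
  refine (Finset.sum_le_sum (g := fun _ => (C.card : ℝ)) fun v _ => ?_).trans (by simp)
  rw [← Finset.sum_add_distrib]
  refine (Finset.sum_le_sum (g := fun _ => (1 : ℝ)) fun v' _ => ?_).trans (by simp)
  by_cases hp : p (ρ v) (ρ v')
  · rw [ind_false (P := ∃ w ∈ B, _)]
    · linarith [ind_le_one (p (ρ v) (ρ v'))]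
    · rintro ⟨w, -, ⟨-, h1⟩, -, h2⟩
      exact h.not_q_z _ _ h1 (h.cherry _ _ _ hp h2)
  · rw [ind_false hp, zero_add]
    exact ind_le_one _

lemma sum_le (h : TwoType p q z D C B R ρ) :
    ∑ u ∈ D, ∑ v ∈ D, (ind (p u v) + ind (q u v) - ind (z u v)) ≤
      C.card * (D.card - B.card) + B.card * (D.card - C.card) + B.card + C.card := by
  rw [h.sum_sum_eq (fun u v => by
    rw [ind_symm h.p_symm, ind_symm h.q_symm, ind_symm h.z_symm]), h.card_eq]
  have split1 : ∀ T U : Finset V, ∑ u ∈ T, ∑ v ∈ U, (ind (p u v) + ind (q u v) - ind (z u v)) =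
      ∑ u ∈ T, ∑ v ∈ U, ind (p u v) + ∑ u ∈ T, ∑ v ∈ U, (ind (q u v) - ind (z u v)) :=
    fun T U => by simp only [Finset.sum_sub_distrib, Finset.sum_add_distrib]; ring
  have split2 : ∀ T U : Finset V, ∑ u ∈ T, ∑ v ∈ U, (ind (p u v) + ind (q u v) - ind (z u v)) =
      ∑ u ∈ T, ∑ v ∈ U, ind (q u v) + ∑ u ∈ T, ∑ v ∈ U, (ind (p u v) - ind (z u v)) :=
    fun T U => by simp only [Finset.sum_sub_distrib, Finset.sum_add_distrib]; ring
  have hRR : ∑ u ∈ R, ∑ v ∈ R, ind (q u v) = 0 :=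
    Finset.sum_eq_zero fun u hu => Finset.sum_eq_zero fun v hv =>
      ind_false (h.not_q_rest u hu v hv)
  have hCB := h.sum_cross_le
  have hΩ := two_mul_edges_le C B fun v w => p v (ρ w) ∧ q (ρ v) w
  have hCC := h.sum_p_square_le
  have hBB := h.swap.sum_p_square_le
  have hcomm : ∑ w ∈ B, ∑ w' ∈ B, ind (∃ v ∈ C, (p v (ρ w) ∧ q (ρ v) w) ∧ p v (ρ w') ∧ q (ρ v) w')
      = ∑ w ∈ B, ∑ w' ∈ B,
        ind (∃ v ∈ C, (q w (ρ v) ∧ p (ρ w) v) ∧ q w' (ρ v) ∧ p (ρ w') v) := by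
    have hp : ∀ u v, p u v ↔ p v u := fun u v => ⟨h.p_symm u v, h.p_symm v u⟩
    have hq : ∀ u v, q u v ↔ q v u := fun u v => ⟨h.q_symm u v, h.q_symm v u⟩
    refine Finset.sum_congr rfl fun w _ => Finset.sum_congr rfl fun w' _ => ?_
    congr 1
    refine propext (exists_congr fun v => ?_)
    rw [hp v (ρ w), hp v (ρ w'), hq (ρ v) w, hq (ρ v) w']
    tauto
  have e1 := h.sum_q_sub_z_le C
  have e2 := h.sum_q_sub_z_le R
  have e3 := h.swap.sum_q_sub_z_le B
  have e4 := h.swap.sum_q_sub_z_le R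
  have e5 := h.sum_p_rest_le
  have e6 := h.swap.sum_p_rest_le
  have e7 := h.sum_rest_nonpos
  rw [split1 C C, split2 B B, split2 R R, split1 C R, split2 B R]
  linarith

end TwoType

end TwoType

/-- The optimisation problem behind the constant `1 + τ²`, in normalised form. -/
lemma no_profile_normalised {τ a d b c l H : ℝ} (hτ0 : 0.15 < τ) (hτ1 : τ < 0.1505)
    (hτ : 9 * τ ^ 2 - 8 * τ + 1 = 0) (ha : 0 ≤ a) (hb : 0 ≤ b) (hc : 0 ≤ c)
    (had : a + d = 1) (hbc : b + c ≤ d) (hba : b ≤ a) (hca : c ≤ a)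
    (hP : τ ^ 2 < c * (d - b)) (hQ : τ ^ 2 < b * (d - c))
    (h1 : 1 + 3 * τ ^ 2 < 2 * a ^ 2 + 2 * H + 2 * (c * (d - b) + b * (d - c)))
    (h2 : H ≤ c * (d - b) + b * (d - c) - 2 * τ ^ 2)
    (h3 : H ≤ a * l) (h4 : H ≤ d ^ 2 - 2 * l ^ 2 - 2 * τ ^ 2) : False := by
  obtain rfl : d = 1 - a := by linarith
  rcases le_or_gt a (1 / 3) with hA | hA
  · have hF : c * (1 - a - b) + b * (1 - a - c) ≤ 2 * a - 4 * a ^ 2 := by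
      nlinarith [mul_nonneg (show 0 ≤ 1 - a - 2 * a by linarith)
        (show 0 ≤ (a - b) + (a - c) by linarith),
        mul_nonneg (sub_nonneg.2 hba) (sub_nonneg.2 hca)]
    nlinarith [sq_nonneg (a - 2 / 7)]
  · set P := c * (1 - a - b) with hPdef
    set Q := b * (1 - a - c) with hQdef
    have hp := Real.sq_sqrt (show 0 ≤ P by nlinarith [sq_nonneg τ])
    have hq := Real.sq_sqrt (show 0 ≤ Q by nlinarith [sq_nonneg τ])
    have hpτ : τ ≤ √P := Real.le_sqrt_of_sq_le hP.le
    have hqτ : τ ≤ √Q := Real.le_sqrt_of_sq_le hQ.le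
    have hp1 : √P ≤ (c + (1 - a - b)) / 2 :=
      Real.sqrt_le_iff.2 ⟨by linarith, by nlinarith [sq_nonneg (c - (1 - a - b))]⟩
    have hq1 : √Q ≤ (b + (1 - a - c)) / 2 :=
      Real.sqrt_le_iff.2 ⟨by linarith, by nlinarith [sq_nonneg (b - (1 - a - c))]⟩
    have hd : 2 * τ ≤ 1 - a := by linarith
    have hF : P + Q ≤ (1 - a - τ) ^ 2 + τ ^ 2 := by
      nlinarith [mul_nonneg (sub_nonneg.2 hpτ) (sub_nonneg.2 hqτ),
        mul_nonneg (show 0 ≤ 1 - a - √P - √Q by linarith) (show 0 ≤ √P + √Q by linarith),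
        mul_nonneg (show 0 ≤ 1 - a - √P - √Q by linarith) (show 0 ≤ 1 - a - τ - τ by linarith)]
    rcases le_or_gt (1 - a) (2 * (1 - τ) / 3) with hD | hD
    · nlinarith [mul_nonneg (sub_nonneg.2 hd) (sub_nonneg.2 hD)]
    · have hH : H ≤ 9 / 32 * a ^ 2 + (1 - a) ^ 2 / 4 - τ ^ 2 / 2 := by
        nlinarith [sq_nonneg (l - 3 / 4 * a)]
      have : 0 ≤ (a - 1 / 3) * (0.4337 - a) := mul_nonneg (by linarith) (by linarith)
      nlinarith

lemma no_profile {τ N a d b c l h : ℝ} (hτ0 : 0.15 < τ) (hτ1 : τ < 0.1505)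
    (hτ : 9 * τ ^ 2 - 8 * τ + 1 = 0) (hN : 0 < N) (ha : 0 ≤ a) (hb : 0 ≤ b) (hc : 0 ≤ c)
    (had : a + d = N) (hbc : b + c ≤ d) (hba : b ≤ a) (hca : c ≤ a)
    (hP : (1 + τ ^ 2) * N ^ 2 + N < N ^ 2 + c * (d - b) + c)
    (hQ : (1 + τ ^ 2) * N ^ 2 + N < N ^ 2 + b * (d - c) + b)
    (h1 : 3 * ((1 + τ ^ 2) * N ^ 2 + N) <
      4 * a ^ 2 + 4 * a * d + 4 * h + 2 * d ^ 2 + 2 * (c * (d - b) + b * (d - c) + b + c))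
    (h2 : 2 * ((1 + τ ^ 2) * N ^ 2 + N) <
      2 * a ^ 2 + 2 * (2 * a * d - h + a) + 2 * d ^ 2 + (c * (d - b) + b * (d - c) + b + c))
    (h3 : 2 * h ≤ a * (l + 1))
    (h4 : 2 * ((1 + τ ^ 2) * N ^ 2 + N) <
      2 * a ^ 2 + 2 * (2 * a * d - h + a) + 3 * d ^ 2 - 2 * l ^ 2) : False := by
  have hN2 : 0 < N ^ 2 := by positivity
  obtain ⟨a, rfl⟩ : ∃ a', a = a' * N := ⟨a / N, by field_simp⟩
  obtain ⟨b, rfl⟩ : ∃ a', b = a' * N := ⟨b / N, by field_simp⟩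
  obtain ⟨c, rfl⟩ : ∃ a', c = a' * N := ⟨c / N, by field_simp⟩
  obtain ⟨d, rfl⟩ : ∃ a', d = a' * N := ⟨d / N, by field_simp⟩
  obtain ⟨l, rfl⟩ : ∃ a', l = a' * N := ⟨l / N, by field_simp⟩
  obtain ⟨H, hH⟩ : ∃ H, 2 * h - a * N = H * N ^ 2 := ⟨(2 * h - a * N) / N ^ 2, by field_simp⟩
  have had' : a + d = 1 := mul_right_cancel₀ hN.ne' (by linarith)
  refine no_profile_normalised (a := a) (b := b) (c := c) (d := d) (l := l) (H := H) hτ0 hτ1 hτ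
    (nonneg_of_mul_nonneg_left ha hN) (nonneg_of_mul_nonneg_left hb hN)
    (nonneg_of_mul_nonneg_left hc hN) had'
    (le_of_mul_le_mul_right (by linarith) hN) (le_of_mul_le_mul_right hba hN)
    (le_of_mul_le_mul_right hca hN) ?_ ?_ ?_ ?_ ?_ ?_
  · refine lt_of_mul_lt_mul_right ?_ hN2.le
    linarith
  · refine lt_of_mul_lt_mul_right ?_ hN2.le
    linarith
  · obtain rfl : d = 1 - a := by linarith
    refine lt_of_mul_lt_mul_right ?_ hN2.le
    linarith
  · obtain rfl : d = 1 - a := by linarith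
    refine le_of_mul_le_mul_right ?_ hN2
    linarith
  · refine le_of_mul_le_mul_right ?_ hN2
    linarith
  · obtain rfl : d = 1 - a := by linarith
    refine le_of_mul_le_mul_right ?_ hN2
    linarith

section Core

variable {V : Type*} {x y t : V → V → Prop} {S A : Finset V} {σ : V → V}

/-- Three symmetric irreflexive relations without a rainbow triangle. -/
structure RainbowFree (x y t : V → V → Prop) : Prop where
  symm_x : ∀ u v, x u v → x v u
  symm_y : ∀ u v, y u v → y v u
  symm_t : ∀ u v, t u v → t v u
  irrefl_x : ∀ u, ¬x u u
  irrefl_y : ∀ u, ¬y u u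
  irrefl_t : ∀ u, ¬t u u
  free : ∀ u v w, x u v → y v w → ¬t u w

/-- Sum of the numbers of ordered pairs in `S` related by `x` and by `y`. -/
noncomputable def edges (S : Finset V) (x y : V → V → Prop) : ℝ :=
  ∑ u ∈ S, ∑ v ∈ S, (ind (x u v) + ind (y u v))

lemma edges_eq (S : Finset V) (x y : V → V → Prop) :
    edges S x y = ∑ u ∈ S, ∑ v ∈ S, ind (x u v) + ∑ u ∈ S, ∑ v ∈ S, ind (y u v) := by
  simp only [edges, Finset.sum_add_distrib]

lemma edges_comm (S : Finset V) (x y : V → V → Prop) : edges S x y = edges S y x := by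
  rw [edges_eq, edges_eq, add_comm]

lemma sum_sum_split [DecidableEq V] {φ : V → V → ℝ} (hA : A ⊆ S) (hφ : ∀ u v, φ u v = φ v u) :
    ∑ u ∈ S, ∑ v ∈ S, φ u v = ∑ u ∈ A, ∑ v ∈ A, φ u v + 2 * ∑ u ∈ A, ∑ v ∈ S \ A, φ u v +
      ∑ u ∈ S \ A, ∑ v ∈ S \ A, φ u v := by
  have h : ∀ f : V → ℝ, ∑ v ∈ S, f v = ∑ v ∈ A, f v + ∑ v ∈ S \ A, f v := fun f => by
    rw [add_comm, Finset.sum_sdiff hA]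
  simp_rw [h, Finset.sum_add_distrib]
  rw [sum_sum_symm (S \ A) A hφ]
  ring

namespace RainbowFree

lemma swap (h : RainbowFree x y t) : RainbowFree y x t where
  symm_x := h.symm_y
  symm_y := h.symm_x
  symm_t := h.symm_t
  irrefl_x := h.irrefl_y
  irrefl_y := h.irrefl_x
  irrefl_t := h.irrefl_t
  free := fun u v w h1 h2 h3 =>
    h.free w v u (h.symm_x _ _ h2) (h.symm_y _ _ h1) (h.symm_t _ _ h3)

lemma rotate (h : RainbowFree x y t) : RainbowFree y t x where
  symm_x := h.symm_y
  symm_y := h.symm_t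
  symm_t := h.symm_x
  irrefl_x := h.irrefl_y
  irrefl_y := h.irrefl_t
  irrefl_t := h.irrefl_x
  free := fun u v w h1 h2 h3 => h.free w u v (h.symm_x _ _ h3) h1 (h.symm_t _ _ h2)

lemma exists_twoType (h : RainbowFree x y t) (hall : ∀ u v, x u v → y u v → ¬t u v)
    (D : Finset V) : ∃ C B R ρ, TwoType (fun u v => x u v ∧ t u v) (fun u v => y u v ∧ t u v)
      (fun u v => u ≠ v ∧ ¬x u v ∧ ¬y u v ∧ ¬t u v) D C B R ρ := by
  classical
  set p : V → V → Prop := fun u v => x u v ∧ t u v with hp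
  set q : V → V → Prop := fun u v => y u v ∧ t u v with hq
  have hps : ∀ u v, p u v → p v u := fun u v e => ⟨h.symm_x _ _ e.1, h.symm_t _ _ e.2⟩
  have hqs : ∀ u v, q u v → q v u := fun u v e => ⟨h.symm_y _ _ e.1, h.symm_t _ _ e.2⟩
  have hpq : ∀ u v, p u v → ¬q u v := fun u v e e' => hall u v e.1 e'.1 e.2
  obtain ⟨M, ρ, hm, hmax⟩ := exists_max_match (fun u v => p u v ∨ q u v) D
  have hs : ∀ u v, p u v ∨ q u v → p v u ∨ q v u := fun u v e => e.imp (hps u v) (hqs u v)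
  have hrest : ∀ u ∈ D \ M, ∀ v ∈ D \ M, ¬(p u v ∨ q u v) := by
    intro u hu v hv
    rw [Finset.mem_sdiff] at hu hv
    by_cases huv : u = v
    · subst huv
      exact fun e => e.elim (fun e => h.irrefl_x _ e.1) fun e => h.irrefl_y _ e.1
    · exact not_edge_of_max hs hm hmax hu.1 hv.1 hu.2 hv.2 huv
  refine ⟨M.filter fun v => p v (ρ v), M.filter fun v => q v (ρ v), D \ M, ρ, ?_⟩
  constructor
  · exact hps
  · exact hqs
  · exact fun u v e => ⟨e.1.symm, fun f => e.2.1 (h.symm_x _ _ f), fun f => e.2.2.1 (h.symm_y _ _ f),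
      fun f => e.2.2.2 (h.symm_t _ _ f)⟩
  · exact hpq
  · exact fun u v e f => f.2.1 e.1
  · exact fun u v e f => f.2.2.1 e.1
  · intro u v w e f
    refine ⟨?_, ?_, ?_, ?_⟩
    · rintro rfl
      exact hpq _ _ e (hqs _ _ f)
    · exact fun g => h.free u w v g (h.symm_y _ _ f.1) e.2
    · exact fun g => h.free v u w (h.symm_x _ _ e.1) g f.2
    · exact fun g => h.free u v w e.1 f.1 g
  · refine ⟨(Finset.filter_subset _ _).trans hm.1, fun v hv => ?_⟩
    rw [Finset.mem_filter] at hv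
    obtain ⟨h1, h2, -⟩ := hm.2 v hv.1
    exact ⟨Finset.mem_filter.2 ⟨h1, by rw [h2]; exact hps _ _ hv.2⟩, h2, hv.2⟩
  · refine ⟨(Finset.filter_subset _ _).trans hm.1, fun v hv => ?_⟩
    rw [Finset.mem_filter] at hv
    obtain ⟨h1, h2, -⟩ := hm.2 v hv.1
    exact ⟨Finset.mem_filter.2 ⟨h1, by rw [h2]; exact hqs _ _ hv.2⟩, h2, hv.2⟩
  · intro f
    rw [← Finset.sum_sdiff hm.1, add_comm, ← Finset.sum_filter_add_sum_filter_not M fun v => p v (ρ v)]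
    congr 3
    refine Finset.filter_congr fun v hv => ?_
    have := (hm.2 v hv).2.2
    have := hpq v (ρ v)
    tauto
  · exact fun u hu v hv e => hrest u hu v hv (Or.inl e)
  · exact fun u hu v hv e => hrest u hu v hv (Or.inr e)
  · intro v hv w hw w' hw' e e'
    rw [Finset.mem_filter] at hv
    rw [Finset.mem_sdiff] at hw hw'
    exact not_augment_of_max hs hm hmax hv.1 hw.1 hw'.1 hw.2 hw'.2 (Or.inl e) (Or.inl e')
  · intro v hv w hw w' hw' e f
    rw [Finset.mem_filter] at hv
    rw [Finset.mem_sdiff] at hw hw'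
    exact not_augment_of_max hs hm hmax hv.1 hw.1 hw'.1 hw.2 hw'.2 (Or.inr e) (Or.inr f)

/-- The relations between the two ends of an edge carrying both `x` and `y` and a vertex. -/
lemma pair_facts (h : RainbowFree x y t) {v v' : V} (hx : x v v') (hy : y v v') (w : V) :
    (t v w → ¬x v' w ∧ ¬y v' w) ∧ (t v' w → ¬x v w ∧ ¬y v w) := by
  refine ⟨fun e => ⟨fun f => ?_, fun f => ?_⟩, fun e => ⟨fun f => ?_, fun f => ?_⟩⟩
  · exact h.swap.free v v' w hy f e
  · exact h.free v v' w hx f e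
  · exact h.swap.free v' v w (h.symm_y _ _ hy) f e
  · exact h.free v' v w (h.symm_x _ _ hx) f e

lemma pair_edges_le (h : RainbowFree x y t) {v v' : V} (hx : x v v') (hy : y v v') (w : V) :
    (ind (x v w) + ind (t v w)) + (ind (x v' w) + ind (t v' w)) ≤ 2 := by
  obtain ⟨h1, h2⟩ := h.pair_facts hx hy w
  by_cases e1 : t v w <;> by_cases e2 : t v' w <;> simp_all [ind] <;> (try split_ifs) <;> norm_num

lemma pair_total_le (h : RainbowFree x y t) (hall : ∀ u v, x u v → y u v → ¬t u v) {v v' : V}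
    (hx : x v v') (hy : y v v') (w : V) :
    (ind (x v w) + ind (y v w) + ind (t v w) - ind (x v w ∧ y v w)) +
      (ind (x v' w) + ind (y v' w) + ind (t v' w) - ind (x v' w ∧ y v' w)) ≤ 2 := by
  obtain ⟨h1, h2⟩ := h.pair_facts hx hy w
  have h3 := hall v w
  have h4 := hall v' w
  by_cases e1 : t v w <;> by_cases e2 : t v' w <;> by_cases e3 : x v w <;> by_cases e4 : x v' w <;>
    by_cases e5 : y v w <;> by_cases e6 : y v' w <;> simp_all [ind] <;> norm_num

lemma pair_sum_le (h : RainbowFree x y t) (hall : ∀ u v, x u v → y u v → ¬t u v) {v v' : V}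
    (hx : x v v') (hy : y v v') (w : V) :
    (ind (x v w) + ind (y v w) + 2 * ind (t v w) + ind (x v w ∧ y v w)) +
      (ind (x v' w) + ind (y v' w) + 2 * ind (t v' w) + ind (x v' w ∧ y v' w)) ≤
      4 + 2 * (ind (x v w ∧ y v w) * ind (x v' w ∧ y v' w)) := by
  obtain ⟨h1, h2⟩ := h.pair_facts hx hy w
  have h3 := hall v w
  have h4 := hall v' w
  by_cases e1 : t v w <;> by_cases e2 : t v' w <;> by_cases e3 : x v w <;> by_cases e4 : x v' w <;>
    by_cases e5 : y v w <;> by_cases e6 : y v' w <;> simp_all [ind] <;> norm_num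

end RainbowFree

end Core

section Final

variable {V : Type*} {x y t : V → V → Prop} {S A : Finset V} {σ : V → V}

namespace RainbowFree

lemma hub (h : RainbowFree x y t) (hm : IsMatch (fun u v => x u v ∧ y u v) S A σ)
    (hmax : ∀ A' σ', IsMatch (fun u v => x u v ∧ y u v) S A' σ' → A'.card ≤ A.card)
    [DecidableEq V] {v : V} (hv : v ∈ A) :
    ∀ w ∈ S \ A, ∀ w' ∈ S \ A, (x v w ∧ y v w) → (x (σ v) w' ∧ y (σ v) w') → w = w' := by
  intro w hw w' hw' e e'
  rw [Finset.mem_sdiff] at hw hw'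
  exact not_augment_of_max (fun u v e => ⟨h.symm_x _ _ e.1, h.symm_y _ _ e.2⟩) hm hmax hv
    hw.1 hw'.1 hw.2 hw'.2 e e'

lemma not_both (h : RainbowFree x y t) (hm : IsMatch (fun u v => x u v ∧ y u v) S A σ)
    (hmax : ∀ A' σ', IsMatch (fun u v => x u v ∧ y u v) S A' σ' → A'.card ≤ A.card)
    [DecidableEq V] : ∀ u ∈ S \ A, ∀ v ∈ S \ A, ¬(x u v ∧ y u v) := by
  intro u hu v hv
  rw [Finset.mem_sdiff] at hu hv
  by_cases huv : u = v
  · subst huv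
    exact fun e => h.irrefl_x _ e.1
  · exact not_edge_of_max (fun u v e => ⟨h.symm_x _ _ e.1, h.symm_y _ _ e.2⟩) hm hmax
      hu.1 hv.1 hu.2 hv.2 huv

/-- A vertex joined to `l` vertices of `D` by both `x` and `y` forces `t` to vanish on them. -/
lemma sum_le_of_nbhd (h : RainbowFree x y t) (D : Finset V)
    (hD : ∀ u ∈ D, ∀ v ∈ D, ¬(x u v ∧ y u v)) (v : V) :
    ∑ u ∈ D, ∑ w ∈ D, (ind (x u w) + ind (y u w) + 2 * ind (t u w)) ≤
      3 * (D.card : ℝ) ^ 2 - 2 * (∑ w ∈ D, ind (x v w ∧ y v w)) ^ 2 := by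
  have h1 : ∀ u ∈ D, ∀ w ∈ D, ind (x u w) + ind (y u w) + 2 * ind (t u w) ≤
      3 - 2 * (ind (x v u ∧ y v u) * ind (x v w ∧ y v w)) := by
    intro u hu w hw
    have e1 := hD u hu w hw
    have e2 : t u w → (x v u ∧ y v u) → ¬(x v w ∧ y v w) := fun e f g =>
      h.free u v w (h.symm_x _ _ f.1) g.2 e
    have e3 : ind (x u w) + ind (y u w) ≤ 1 := by
      by_cases e : x u w <;> by_cases f : y u w <;> simp_all [ind]
    have e4 : ind (t u w) ≤ 1 - ind (x v u ∧ y v u) * ind (x v w ∧ y v w) := by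
      by_cases e : x v u ∧ y v u
      · by_cases f : x v w ∧ y v w
        · rw [ind_false fun g => e2 g e f, ind_true e, ind_true f]
          norm_num
        · rw [ind_false f, mul_zero, sub_zero]
          exact ind_le_one _
      · rw [ind_false e, zero_mul, sub_zero]
        exact ind_le_one _
    linarith
  refine (Finset.sum_le_sum fun u hu => Finset.sum_le_sum (h1 u hu)).trans (le_of_eq ?_)
  simp only [Finset.sum_sub_distrib, ← Finset.mul_sum, Finset.sum_const, nsmul_eq_mul,
    ← Finset.sum_mul]
  ring

lemma exists_nbhd (h : RainbowFree x y t) (D : Finset V)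
    (hD : ∀ u ∈ D, ∀ v ∈ D, ¬(x u v ∧ y u v)) {A : Finset V} (hA : A.Nonempty) :
    ∃ l : ℝ, 0 ≤ l ∧ (∀ v ∈ A, ∑ w ∈ D, ind (x v w ∧ y v w) ≤ l) ∧
      ∑ u ∈ D, ∑ w ∈ D, (ind (x u w) + ind (y u w) + 2 * ind (t u w)) ≤
        3 * (D.card : ℝ) ^ 2 - 2 * l ^ 2 := by
  obtain ⟨v, -, hv⟩ := Finset.exists_max_image A (fun v => ∑ w ∈ D, ind (x v w ∧ y v w)) hA
  exact ⟨_, Finset.sum_nonneg fun _ _ => ind_nonneg _, hv, h.sum_le_of_nbhd D hD v⟩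

lemma le_of_not_both (h : RainbowFree x y t) {u v : V} (hxy : ¬(x u v ∧ y u v)) :
    ind (x u v) + ind (t u v) ≤ 1 + (ind (x u v ∧ t u v) -
      ind (u ≠ v ∧ ¬x u v ∧ ¬y u v ∧ ¬t u v)) ∧
    ind (y u v) + ind (t u v) ≤ 1 + (ind (y u v ∧ t u v) -
      ind (u ≠ v ∧ ¬x u v ∧ ¬y u v ∧ ¬t u v)) ∧
    ind (x u v) + ind (y u v) + ind (t u v) ≤ 1 + (ind (x u v ∧ t u v) + ind (y u v ∧ t u v) -
      ind (u ≠ v ∧ ¬x u v ∧ ¬y u v ∧ ¬t u v)) ∧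
    ind (x u v) + ind (y u v) + 2 * ind (t u v) ≤ 2 + (ind (x u v ∧ t u v) +
      ind (y u v ∧ t u v) - ind (u ≠ v ∧ ¬x u v ∧ ¬y u v ∧ ¬t u v)) := by
  by_cases huv : u = v
  · subst huv
    simp [ind, h.irrefl_x u, h.irrefl_y u, h.irrefl_t u]
  · by_cases e2 : x u v <;> by_cases e3 : y u v <;> by_cases e4 : t u v <;> simp_all [ind] <;>
      norm_num

lemma sum_both_le (h : RainbowFree x y t) (hm : IsMatch (fun u v => x u v ∧ y u v) S A σ)
    (hmax : ∀ A' σ', IsMatch (fun u v => x u v ∧ y u v) S A' σ' → A'.card ≤ A.card)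
    [DecidableEq V] {l : ℝ} (hl : 0 ≤ l)
    (hle : ∀ v ∈ A, ∑ w ∈ S \ A, ind (x v w ∧ y v w) ≤ l) :
    2 * ∑ v ∈ A, ∑ w ∈ S \ A, ind (x v w ∧ y v w) ≤ A.card * (l + 1) := by
  have := sum_le_of_match hm (fun v => ∑ w ∈ S \ A, ind (x v w ∧ y v w)) ((l + 1) / 2)
    (fun v hv => by
      have := sum_ind_add_le hl (h.hub hm hmax hv) (hle v hv) (hle _ (hm.2 v hv).1)
      linarith)
  linarith

lemma sum_pair_le (h : RainbowFree x y t) (hm : IsMatch (fun u v => x u v ∧ y u v) S A σ)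
    (T : Finset V) : ∑ v ∈ A, ∑ w ∈ T, (ind (x v w) + ind (t v w)) ≤ A.card * T.card := by
  have := sum_sum_le_of_match hm T (fun v w => ind (x v w) + ind (t v w)) 1 (fun v hv w _ => by
    have := h.pair_edges_le (hm.2 v hv).2.2.1 (hm.2 v hv).2.2.2 w
    linarith)
  linarith

lemma sum_total_le (h : RainbowFree x y t) (hall : ∀ u v, x u v → y u v → ¬t u v)
    (hm : IsMatch (fun u v => x u v ∧ y u v) S A σ) (T : Finset V) :
    ∑ v ∈ A, ∑ w ∈ T, (ind (x v w) + ind (y v w) + ind (t v w)) ≤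
      A.card * T.card + ∑ v ∈ A, ∑ w ∈ T, ind (x v w ∧ y v w) := by
  have := sum_sum_le_of_match hm T
    (fun v w => ind (x v w) + ind (y v w) + ind (t v w) - ind (x v w ∧ y v w)) 1
    (fun v hv w _ => by
      have := h.pair_total_le hall (hm.2 v hv).2.2.1 (hm.2 v hv).2.2.2 w
      linarith)
  simp only [Finset.sum_sub_distrib] at this
  linarith

lemma sum_cross_le (h : RainbowFree x y t) (hall : ∀ u v, x u v → y u v → ¬t u v)
    (hm : IsMatch (fun u v => x u v ∧ y u v) S A σ)
    (hmax : ∀ A' σ', IsMatch (fun u v => x u v ∧ y u v) S A' σ' → A'.card ≤ A.card)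
    [DecidableEq V] :
    ∑ v ∈ A, ∑ w ∈ S \ A, (ind (x v w) + ind (y v w) + 2 * ind (t v w)) ≤
      2 * A.card * (S \ A).card + A.card - ∑ v ∈ A, ∑ w ∈ S \ A, ind (x v w ∧ y v w) := by
  have h1 := sum_sum_le_of_match hm (S \ A)
    (fun v w => ind (x v w) + ind (y v w) + 2 * ind (t v w) + ind (x v w ∧ y v w) -
      ind (x v w ∧ y v w) * ind (x (σ v) w ∧ y (σ v) w)) 2
    (fun v hv w _ => by
      have := h.pair_sum_le hall (hm.2 v hv).2.2.1 (hm.2 v hv).2.2.2 w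
      simp only [(hm.2 v hv).2.1]
      linarith)
  have h2 : ∑ v ∈ A, ∑ w ∈ S \ A, ind (x v w ∧ y v w) * ind (x (σ v) w ∧ y (σ v) w) ≤ A.card := by
    refine (Finset.sum_le_sum fun v hv => sum_ind_mul_le (h.hub hm hmax hv)).trans ?_
    simp
  simp only [Finset.sum_sub_distrib, Finset.sum_add_distrib] at h1 ⊢
  linarith

end RainbowFree

lemma edges_total (S : Finset V) (x y t : V → V → Prop) :
    edges S x y + edges S x t + edges S y t =
      2 * ∑ u ∈ S, ∑ v ∈ S, (ind (x u v) + ind (y u v) + ind (t u v)) := by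
  simp only [edges_eq, Finset.sum_add_distrib]
  ring

lemma edges_add (S : Finset V) (x y t : V → V → Prop) :
    edges S x t + edges S y t =
      ∑ u ∈ S, ∑ v ∈ S, (ind (x u v) + ind (y u v) + 2 * ind (t u v)) := by
  simp only [edges_eq, Finset.sum_add_distrib, ← Finset.mul_sum]
  ring

open TwoType in
/-- Three rainbow-free relations, no pair carrying all three, whose largest matching of pairs
with two relations is one of `x` and `y`, cannot all be dense. -/
lemma RainbowFree.not_dense_of_max (h : RainbowFree x y t)
    (hall : ∀ u v, x u v → y u v → ¬t u v) {τ : ℝ} (hτ0 : 0.15 < τ) (hτ1 : τ < 0.1505)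
    (hτ : 9 * τ ^ 2 - 8 * τ + 1 = 0) (hm : IsMatch (fun u v => x u v ∧ y u v) S A σ)
    (hmax : ∀ A' σ', IsMatch (fun u v => x u v ∧ y u v) S A' σ' → A'.card ≤ A.card)
    (hmax' : ∀ A' σ', IsMatch (fun u v => x u v ∧ t u v) S A' σ' → A'.card ≤ A.card)
    (hmax'' : ∀ A' σ', IsMatch (fun u v => y u v ∧ t u v) S A' σ' → A'.card ≤ A.card)
    (hxy : (1 + τ ^ 2) * (S.card : ℝ) ^ 2 + S.card < edges S x y)
    (hxt : (1 + τ ^ 2) * (S.card : ℝ) ^ 2 + S.card < edges S x t)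
    (hyt : (1 + τ ^ 2) * (S.card : ℝ) ^ 2 + S.card < edges S y t) : False := by
  classical
  have hN : (0 : ℝ) < S.card := by
    rw [Nat.cast_pos, Finset.card_pos]
    by_contra hS
    rw [Finset.not_nonempty_iff_eq_empty] at hS
    simp [hS, edges] at hxy
  have hD := h.not_both hm hmax
  obtain ⟨C, B, R, ρ, hT⟩ := h.exists_twoType hall (S \ A)
  have hc : C.card ≤ A.card :=
    hmax' C ρ ⟨hT.match_p.1.trans Finset.sdiff_subset, hT.match_p.2⟩
  have hb : B.card ≤ A.card :=
    hmax'' B ρ ⟨hT.match_q.1.trans Finset.sdiff_subset, hT.match_q.2⟩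
  have hcard : (A.card : ℝ) + (S \ A).card = S.card := by
    rw [← Nat.cast_add, add_comm, Finset.card_sdiff_add_card_eq_card hm.1]
  have hcb := hT.card_eq
  have hP := hT.sum_p_sub_z_le
  have hQ := hT.swap.sum_p_sub_z_le
  have hG := hT.sum_le
  have hsx := ind_symm h.symm_x
  have hsy := ind_symm h.symm_y
  have hst := ind_symm h.symm_t
  have hloc := fun u hu v hv => h.le_of_not_both (hD u hu v hv)
  set D := S \ A with hDdef
  have hsum : ∀ {f g : V → V → ℝ} (k : ℝ), (∀ u ∈ D, ∀ v ∈ D, f u v ≤ k + g u v) →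
      ∑ u ∈ D, ∑ v ∈ D, f u v ≤ k * (D.card : ℝ) ^ 2 + ∑ u ∈ D, ∑ v ∈ D, g u v := by
    intro f g k hfg
    refine (Finset.sum_le_sum fun u hu => Finset.sum_le_sum (hfg u hu)).trans (le_of_eq ?_)
    simp only [Finset.sum_add_distrib, Finset.sum_const, nsmul_eq_mul]
    ring
  have hDx := hsum 1 fun u hu v hv => (hloc u hu v hv).1
  have hDy := hsum 1 fun u hu v hv => (hloc u hu v hv).2.1
  have hDT := hsum 1 fun u hu v hv => (hloc u hu v hv).2.2.1
  have hDS := hsum 2 fun u hu v hv => (hloc u hu v hv).2.2.2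
  have sxt := sum_sum_split (φ := fun u v => ind (x u v) + ind (t u v)) hm.1
    (fun u v => by rw [hsx, hst])
  have syt := sum_sum_split (φ := fun u v => ind (y u v) + ind (t u v)) hm.1
    (fun u v => by rw [hsy, hst])
  have sT := sum_sum_split (φ := fun u v => ind (x u v) + ind (y u v) + ind (t u v)) hm.1
    (fun u v => by rw [hsx, hsy, hst])
  have sS := sum_sum_split (φ := fun u v => ind (x u v) + ind (y u v) + 2 * ind (t u v)) hm.1
    (fun u v => by rw [hsx, hsy, hst])
  have hm' : IsMatch (fun u v => y u v ∧ x u v) S A σ :=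
    ⟨hm.1, fun v hv => ⟨(hm.2 v hv).1, (hm.2 v hv).2.1, (hm.2 v hv).2.2.symm⟩⟩
  have hAAx := h.sum_pair_le hm A
  have hADx := h.sum_pair_le hm D
  have hAAy := h.swap.sum_pair_le hm' A
  have hADy := h.swap.sum_pair_le hm' D
  have hAAT := h.sum_total_le hall hm A
  have hADT := h.sum_total_le hall hm D
  have hbAA := sum_sum_ind_le_card A A fun u v => x u v ∧ y u v
  have hADS := h.sum_cross_le hall hm hmax
  have hAAS : ∑ v ∈ A, ∑ w ∈ A, (ind (x v w) + ind (y v w) + 2 * ind (t v w)) =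
      ∑ v ∈ A, ∑ w ∈ A, (ind (x v w) + ind (t v w)) +
        ∑ v ∈ A, ∑ w ∈ A, (ind (y v w) + ind (t v w)) := by
    simp only [Finset.sum_add_distrib, ← Finset.mul_sum]
    ring
  have hET := edges_total S x y t
  have hES := edges_add S x y t
  simp only [edges] at hxt hyt hET hES hxy
  have hS : (S.card : ℝ) ^ 2 = (A.card : ℝ) ^ 2 + 2 * A.card * D.card + (D.card : ℝ) ^ 2 := by
    rw [← hcard]
    ring
  have hR : (0 : ℝ) ≤ R.card := Nat.cast_nonneg _
  have hxt' : (1 + τ ^ 2) * (S.card : ℝ) ^ 2 + S.card <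
      S.card ^ 2 + C.card * (D.card - B.card) + C.card := by
    linarith only [hxt, sxt, hAAx, hADx, hDx, hP, hS]
  have hA : A.Nonempty := by
    rw [← Finset.card_pos]
    by_contra hA
    have : C.card = 0 := by omega
    rw [this, Nat.cast_zero] at hxt'
    linarith only [hxt', hN, mul_nonneg (sq_nonneg τ) (sq_nonneg (S.card : ℝ))]
  obtain ⟨l, hl0, hl1, hl2⟩ := h.exists_nbhd D hD hA
  refine no_profile (τ := τ) (N := S.card) (a := A.card) (d := D.card) (b := B.card) (c := C.card)
    (l := l) (h := ∑ v ∈ A, ∑ w ∈ D, ind (x v w ∧ y v w)) hτ0 hτ1 hτ hN (Nat.cast_nonneg _)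
    (Nat.cast_nonneg _) (Nat.cast_nonneg _) hcard (by linarith only [hcb, hR]) (by exact_mod_cast hb)
    (by exact_mod_cast hc) hxt' ?_ ?_ ?_ (h.sum_both_le hm hmax hl0 hl1) ?_
  · linarith only [hyt, syt, hAAy, hADy, hDy, hQ, hS]
  · linarith only [hxy, hxt, hyt, hET, sT, hAAT, hbAA, hADT, hDT, hG]
  · linarith only [hxt, hyt, hES, sS, hAAS, hAAx, hAAy, hADS, hDS, hG]
  · linarith only [hxt, hyt, hES, sS, hAAS, hAAx, hAAy, hADS, hl2]

end Final

section Dense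

variable {V : Type*} {x y t : V → V → Prop} {S A : Finset V} {σ : V → V}

lemma isMatch_and_comm (x y : V → V → Prop) :
    IsMatch (fun u v => x u v ∧ y u v) S A σ ↔ IsMatch (fun u v => y u v ∧ x u v) S A σ := by
  simp only [IsMatch, and_comm]

/-- Three rainbow-free relations with no pair carrying all three cannot all be dense. -/
lemma RainbowFree.not_dense_of_not_all (h : RainbowFree x y t)
    (hall : ∀ u v, x u v → y u v → ¬t u v) {τ : ℝ} (hτ0 : 0.15 < τ) (hτ1 : τ < 0.1505)
    (hτ : 9 * τ ^ 2 - 8 * τ + 1 = 0)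
    (hxy : (1 + τ ^ 2) * (S.card : ℝ) ^ 2 + S.card < edges S x y)
    (hxt : (1 + τ ^ 2) * (S.card : ℝ) ^ 2 + S.card < edges S x t)
    (hyt : (1 + τ ^ 2) * (S.card : ℝ) ^ 2 + S.card < edges S y t) : False := by
  obtain ⟨A₁, σ₁, hm₁, hmax₁⟩ := exists_max_match (fun u v => x u v ∧ y u v) S
  obtain ⟨A₂, σ₂, hm₂, hmax₂⟩ := exists_max_match (fun u v => x u v ∧ t u v) S
  obtain ⟨A₃, σ₃, hm₃, hmax₃⟩ := exists_max_match (fun u v => y u v ∧ t u v) S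
  rcases (by omega : (A₂.card ≤ A₁.card ∧ A₃.card ≤ A₁.card) ∨
    (A₁.card ≤ A₂.card ∧ A₃.card ≤ A₂.card) ∨ (A₁.card ≤ A₃.card ∧ A₂.card ≤ A₃.card))
    with h' | h' | h'
  · exact h.not_dense_of_max hall hτ0 hτ1 hτ hm₁ hmax₁ (fun _ _ e => (hmax₂ _ _ e).trans h'.1)
      (fun _ _ e => (hmax₃ _ _ e).trans h'.2) hxy hxt hyt
  · exact h.swap.rotate.not_dense_of_max (fun u v e f g => hall u v e g f) hτ0 hτ1 hτ hm₂ hmax₂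
      (fun _ _ e => (hmax₁ _ _ e).trans h'.1)
      (fun _ _ e => (hmax₃ _ _ ((isMatch_and_comm _ _).1 e)).trans h'.2) hxt hxy
      (by rwa [edges_comm])
  · exact h.rotate.not_dense_of_max (fun u v e f g => hall u v g e f) hτ0 hτ1 hτ hm₃ hmax₃
      (fun _ _ e => (hmax₁ _ _ ((isMatch_and_comm _ _).1 e)).trans h'.1)
      (fun _ _ e => (hmax₂ _ _ ((isMatch_and_comm _ _).1 e)).trans h'.2) hyt
      (by rwa [edges_comm]) (by rwa [edges_comm])

/-- Deleting a matching of pairs carrying `x` and `y` preserves the density of `x` and `t`. -/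
lemma RainbowFree.lt_edges_sdiff (h : RainbowFree x y t) [DecidableEq V] {κ : ℝ} (hκ : 0 ≤ κ)
    (hm : IsMatch (fun u v => x u v ∧ y u v) S A σ)
    (hxt : (1 + κ) * (S.card : ℝ) ^ 2 + S.card < edges S x t) :
    (1 + κ) * ((S \ A).card : ℝ) ^ 2 + (S \ A).card < edges (S \ A) x t := by
  have h1 := h.sum_pair_le hm A
  have h2 := h.sum_pair_le hm (S \ A)
  have h3 := sum_sum_split (φ := fun u v => ind (x u v) + ind (t u v)) hm.1
    (fun u v => by rw [TwoType.ind_symm h.symm_x, TwoType.ind_symm h.symm_t])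
  have hcard : (S.card : ℝ) = A.card + (S \ A).card := by
    rw [← Nat.cast_add, add_comm, Finset.card_sdiff_add_card_eq_card hm.1]
  simp only [edges] at hxt ⊢
  have hA : (0 : ℝ) ≤ A.card := Nat.cast_nonneg _
  have hD : (0 : ℝ) ≤ (S \ A).card := Nat.cast_nonneg _
  rw [hcard] at hxt
  have h4 : 0 ≤ κ * ((A.card : ℝ) ^ 2 + 2 * (A.card * (S \ A).card)) := by positivity
  linarith

/-- Three rainbow-free symmetric relations cannot all be dense. -/
lemma RainbowFree.not_dense (h : RainbowFree x y t) {τ : ℝ} (hτ0 : 0.15 < τ) (hτ1 : τ < 0.1505)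
    (hτ : 9 * τ ^ 2 - 8 * τ + 1 = 0)
    (hxy : (1 + τ ^ 2) * (S.card : ℝ) ^ 2 + S.card < edges S x y)
    (hxt : (1 + τ ^ 2) * (S.card : ℝ) ^ 2 + S.card < edges S x t)
    (hyt : (1 + τ ^ 2) * (S.card : ℝ) ^ 2 + S.card < edges S y t) : False := by
  classical
  obtain ⟨A, σ, hm, hmax⟩ := exists_max_match (fun u v => x u v ∧ y u v ∧ t u v) S
  have weaken : ∀ P : V → V → Prop, (∀ u v, x u v ∧ y u v ∧ t u v → P u v) → IsMatch P S A σ :=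
    fun P hP => ⟨hm.1, fun v hv => ⟨(hm.2 v hv).1, (hm.2 v hv).2.1, hP _ _ (hm.2 v hv).2.2⟩⟩
  have hxy' := h.swap.rotate.lt_edges_sdiff (sq_nonneg τ) (weaken _ fun u v e => ⟨e.1, e.2.2⟩) hxy
  have hxt' := h.lt_edges_sdiff (sq_nonneg τ) (weaken _ fun u v e => ⟨e.1, e.2.1⟩) hxt
  have hyt' := h.swap.lt_edges_sdiff (sq_nonneg τ) (weaken _ fun u v e => ⟨e.2.1, e.1⟩) hyt
  have hno : ∀ u ∈ S \ A, ∀ v ∈ S \ A, ¬(x u v ∧ y u v ∧ t u v) := by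
    intro u hu v hv
    rw [Finset.mem_sdiff] at hu hv
    by_cases huv : u = v
    · subst huv
      exact fun e => h.irrefl_x _ e.1
    · exact not_edge_of_max
        (fun u v e => ⟨h.symm_x _ _ e.1, h.symm_y _ _ e.2.1, h.symm_t _ _ e.2.2⟩) hm hmax
        hu.1 hv.1 hu.2 hv.2 huv
  set D := S \ A
  have hrestrict : ∀ x y : V → V → Prop, edges D x y =
      edges D (fun u v => u ∈ D ∧ v ∈ D ∧ x u v) fun u v => u ∈ D ∧ v ∈ D ∧ y u v := by
    intro x y
    refine Finset.sum_congr rfl fun u hu => Finset.sum_congr rfl fun v hv => ?_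
    simp only [hu, hv, true_and]
  rw [hrestrict] at hxy' hxt' hyt'
  refine not_dense_of_not_all ?_ ?_ hτ0 hτ1 hτ hxy' hxt' hyt'
  · exact
      { symm_x := fun u v e => ⟨e.2.1, e.1, h.symm_x _ _ e.2.2⟩
        symm_y := fun u v e => ⟨e.2.1, e.1, h.symm_y _ _ e.2.2⟩
        symm_t := fun u v e => ⟨e.2.1, e.1, h.symm_t _ _ e.2.2⟩
        irrefl_x := fun u e => h.irrefl_x _ e.2.2
        irrefl_y := fun u e => h.irrefl_y _ e.2.2
        irrefl_t := fun u e => h.irrefl_t _ e.2.2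
        free := fun u v w e f g => h.free u v w e.2.2 f.2.2 g.2.2 }
  · exact fun u v e f g => hno u e.1 v e.2.1 ⟨e.2.2, f.2.2, g.2.2⟩

end Dense

section Doubling

variable {n : ℕ}

/-- The place of a doubled vertex in the palindromic order `0, 1, …, n - 1, n - 1, …, 1, 0`. -/
def place (x : Fin n × Bool) : ℤ := if x.2 then 2 * n - x.1 else x.1

/-- The symmetric relation on doubled vertices obtained by reading `g` along the palindromic
order. -/
def doubled (g : Finset (Fin n × Fin n)) (x y : Fin n × Bool) : Prop :=
  x.1 ≠ y.1 ∧ ((place x < place y ∧ (x.1, y.1) ∈ g) ∨ (place y < place x ∧ (y.1, x.1) ∈ g))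

lemma doubled_symm (g : Finset (Fin n × Fin n)) (x y : Fin n × Bool) (h : doubled g x y) :
    doubled g y x := ⟨h.1.symm, h.2.symm⟩

lemma doubled_of_lt {g : Finset (Fin n × Fin n)} {x y : Fin n × Bool} (hne : x.1 ≠ y.1)
    (h : place x < place y) : doubled g x y ↔ (x.1, y.1) ∈ g := by
  simp [doubled, hne, h, h.not_gt]

lemma doubled_of_gt {g : Finset (Fin n × Fin n)} {x y : Fin n × Bool} (hne : x.1 ≠ y.1)
    (h : place y < place x) : doubled g x y ↔ (y.1, x.1) ∈ g := by
  simp [doubled, hne, h, h.not_gt]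

lemma sum_doubled_of_lt (g : Finset (Fin n × Fin n)) {u v : Fin n} (h : u < v) :
    ∑ a : Bool, ∑ b : Bool, ind (doubled g (u, a) (v, b)) =
      2 * ind ((u, v) ∈ g) + 2 * ind ((v, u) ∈ g) := by
  have h' : (u : ℕ) < v := h
  have hu := u.2
  have hv := v.2
  simp only [Fintype.sum_bool]
  rw [doubled_of_gt (x := (u, true)) (y := (v, true)) h.ne (by simp [place]; omega),
    doubled_of_gt (x := (u, true)) (y := (v, false)) h.ne (by simp [place]; omega),
    doubled_of_lt (x := (u, false)) (y := (v, true)) h.ne (by simp [place]; omega),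
    doubled_of_lt (x := (u, false)) (y := (v, false)) h.ne (by simp [place]; omega)]
  ring

lemma sum_doubled_of_ne (g : Finset (Fin n × Fin n)) {u v : Fin n} (h : u ≠ v) :
    ∑ a : Bool, ∑ b : Bool, ind (doubled g (u, a) (v, b)) =
      2 * ind ((u, v) ∈ g) + 2 * ind ((v, u) ∈ g) := by
  rcases h.lt_or_gt with h | h
  · exact sum_doubled_of_lt g h
  · rw [Finset.sum_comm, add_comm, ← sum_doubled_of_lt g h]
    exact Finset.sum_congr rfl fun a _ => Finset.sum_congr rfl fun b _ =>
      TwoType.ind_symm (doubled_symm g) _ _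

lemma sum_ind_mem (g : Finset (Fin n × Fin n)) :
    ∑ u : Fin n, ∑ v : Fin n, ind ((u, v) ∈ g) = g.card := by
  rw [← Fintype.sum_prod_type (f := fun e : Fin n × Fin n => ind (e ∈ g))]
  have h : ∀ e, ind (e ∈ g) = if e ∈ g then (1 : ℝ) else 0 := fun e => by
    by_cases he : e ∈ g <;> simp [ind, he]
  simp [h]

lemma four_mul_card_le (g : Finset (Fin n × Fin n)) (hg : ∀ e ∈ g, e.1 ≠ e.2) :
    4 * (g.card : ℝ) ≤ ∑ x : Fin n × Bool, ∑ y : Fin n × Bool, ind (doubled g x y) := by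
  have h1 : ∑ x : Fin n × Bool, ∑ y : Fin n × Bool, ind (doubled g x y) =
      ∑ u : Fin n, ∑ v : Fin n, ∑ a : Bool, ∑ b : Bool, ind (doubled g (u, a) (v, b)) := by
    simp only [Fintype.sum_prod_type]
    exact Finset.sum_congr rfl fun u _ => Finset.sum_comm
  have h2 : 4 * (g.card : ℝ) =
      ∑ u : Fin n, ∑ v : Fin n, (2 * ind ((u, v) ∈ g) + 2 * ind ((v, u) ∈ g)) := by
    have h3 : ∑ u : Fin n, ∑ v : Fin n, ind ((v, u) ∈ g) = g.card := by
      rw [Finset.sum_comm, sum_ind_mem]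
    simp only [Finset.sum_add_distrib, ← Finset.mul_sum, sum_ind_mem, h3]
    ring
  rw [h1, h2]
  refine Finset.sum_le_sum fun u _ => Finset.sum_le_sum fun v _ => ?_
  by_cases huv : u = v
  · subst huv
    rw [ind_false fun e => hg _ e rfl]
    rw [mul_zero, add_zero]
    exact Finset.sum_nonneg fun a _ => Finset.sum_nonneg fun b _ => ind_nonneg _
  · exact (sum_doubled_of_ne g huv).ge

end Doubling

/-- If three directed graphs on a common set of `n` vertices satisfy
`e(G_i) + e(G_j) > ((104 - 8√7)/81)·n^2 + 3n` for every pair `i < j`, then there is a rainbow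
transitive triangle. -/
theorem rainbow_transitive_triangle_pairwise_edges
    (n : ℕ) (G : Fin 3 → Finset (Fin n × Fin n))
    (hloop : ∀ i : Fin 3, ∀ e ∈ G i, e.1 ≠ e.2)
    (hE : ∀ i j : Fin 3, i < j →
        ((G i).card : ℝ) + ((G j).card : ℝ) >
          ((104 - 8 * Real.sqrt 7) / 81) * (n : ℝ) ^ 2 + 3 * (n : ℝ)) :
    ∃ u v w : Fin n, ∃ i j k : Fin 3,
      u ≠ v ∧ v ≠ w ∧ u ≠ w ∧ i ≠ j ∧ j ≠ k ∧ i ≠ k ∧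
      (u, v) ∈ G i ∧ (v, w) ∈ G j ∧ (u, w) ∈ G k := by
  by_contra hno
  have hno' : ∀ (u v w : Fin n) (i j k : Fin 3), u ≠ v → v ≠ w → u ≠ w → i ≠ j → j ≠ k → i ≠ k →
      (u, v) ∈ G i → (v, w) ∈ G j → (u, w) ∈ G k → False :=
    fun u v w i j k h1 h2 h3 h4 h5 h6 h7 h8 h9 =>
      hno ⟨u, v, w, i, j, k, h1, h2, h3, h4, h5, h6, h7, h8, h9⟩
  have hfree : RainbowFree (doubled (G 0)) (doubled (G 1)) (doubled (G 2)) := by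
    refine ⟨doubled_symm _, doubled_symm _, doubled_symm _, fun _ e => e.1 rfl, fun _ e => e.1 rfl,
      fun _ e => e.1 rfl, ?_⟩
    rintro u v w ⟨h1, ⟨p1, e1⟩ | ⟨p1, e1⟩⟩ ⟨h2, ⟨p2, e2⟩ | ⟨p2, e2⟩⟩ ⟨h3, ⟨p3, e3⟩ | ⟨p3, e3⟩⟩
    · exact hno' _ _ _ 0 1 2 h1 h2 h3 (by decide) (by decide) (by decide) e1 e2 e3
    · exact absurd (p1.trans p2) p3.not_gt
    · exact hno' _ _ _ 2 1 0 h3 h2.symm h1 (by decide) (by decide) (by decide) e3 e2 e1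
    · exact hno' _ _ _ 2 0 1 h3.symm h1 h2.symm (by decide) (by decide) (by decide) e3 e1 e2
    · exact hno' _ _ _ 0 2 1 h1.symm h3 h2 (by decide) (by decide) (by decide) e1 e3 e2
    · exact hno' _ _ _ 1 2 0 h2 h3.symm h1.symm (by decide) (by decide) (by decide) e2 e3 e1
    · exact absurd (p2.trans p1) p3.not_gt
    · exact hno' _ _ _ 1 0 2 h2.symm h1.symm h3.symm (by decide) (by decide) (by decide) e2 e1 e3
  have h7 : √7 ^ 2 = 7 := Real.sq_sqrt (by norm_num)
  have h7a : 2.6456 < √7 := Real.lt_sqrt_of_sq_lt (by norm_num)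
  have h7b : √7 < 2.65 := (Real.sqrt_lt' (by norm_num)).2 (by norm_num)
  have hdense : ∀ i j : Fin 3, i < j →
      (1 + ((4 - √7) / 9) ^ 2) * ((Finset.univ : Finset (Fin n × Bool)).card : ℝ) ^ 2 +
        (Finset.univ : Finset (Fin n × Bool)).card <
      edges Finset.univ (doubled (G i)) (doubled (G j)) := by
    intro i j hij
    have h1 := hE i j hij
    have h2 := four_mul_card_le (G i) (hloop i)
    have h3 := four_mul_card_le (G j) (hloop j)
    have h4 : (1 + ((4 - √7) / 9) ^ 2) = (104 - 8 * √7) / 81 := by linear_combination h7 / 81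
    rw [edges_eq, h4]
    simp only [Finset.card_univ, Fintype.card_prod, Fintype.card_fin, Fintype.card_bool,
      Nat.cast_mul, Nat.cast_ofNat]
    have h5 : (0 : ℝ) ≤ n := Nat.cast_nonneg n
    linarith
  exact hfree.not_dense (S := Finset.univ) (τ := (4 - √7) / 9) (by linarith) (by linarith)
    (by linear_combination h7 / 9) (hdense 0 1 (by decide)) (hdense 0 2 (by decide))
    (hdense 1 2 (by decide))
end

section
/- Let G_1, G_2, ..., G_c be c ≥ 3 oriented graphs on a common set of n vertices. If the total number of edges satisfies e(G_1) + e(G_2) + ... + e(G_c) > (c/3)n^2, then there exists a rainbow transitive triangle. -/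
/-- A set of colors among three given ones, recorded by its indicator. -/
abbrev ColorSet := Bool × Bool × Bool

namespace ColorSet

/-- The number of colors in a color set. -/
def size (p : ColorSet) : ℕ := p.1.toNat + p.2.1.toNat + p.2.2.toNat

/-- Two color sets have no common color. -/
def Disj (p q : ColorSet) : Bool :=
  !(p.1 && q.1) && !(p.2.1 && q.2.1) && !(p.2.2 && q.2.2)

/-- Three color sets have a system of distinct representatives. -/
def Rainbow (p q r : ColorSet) : Bool :=
  (p.1 && ((q.2.1 && r.2.2) || (q.2.2 && r.2.1))) ||
  (p.2.1 && ((q.1 && r.2.2) || (q.2.2 && r.1))) ||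
  (p.2.2 && ((q.1 && r.2.1) || (q.2.1 && r.1)))

theorem size_add_size_le {p q : ColorSet} : Disj p q → size p + size q ≤ 3 := by
  revert p q; decide

set_option synthInstance.maxSize 1000 in
/-- Let `p, q, r` be the colors of `ab, bc, ca` and `p', q', r'` those of the reversed pairs. If
they carry at least eight edges but no rainbow transitive triangle, then all of these edges go
around the triangle in the same direction. -/
theorem cyclic_of_eight_le_size : ∀ p p' : ColorSet, Disj p p' → 2 ≤ size p + size p' →
    ∀ q q' : ColorSet, Disj q q' → 5 ≤ size p + size p' + size q + size q' →
    ∀ r : ColorSet, Rainbow q r p' = false → Rainbow r p q' = false →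
    ∀ r' : ColorSet, Rainbow p q r' = false → Rainbow r' q' p = false →
    Rainbow p' r' q = false → Rainbow q' p' r = false → Disj r r' →
    8 ≤ size p + size p' + size q + size q' + size r + size r' →
    size p' + size q' + size r' = 0 ∨ size p + size q + size r = 0 := by
  decide +kernel

set_option synthInstance.maxSize 1000 in
/-- Let `p, q, r` be the colors of `ab, bc, ca`, let `s, t, u` be those of `xa, xb, xc`, and let
`s', t', u'` be those of the reversed pairs. If `ab, bc, ca` carry at least eight edges and `xa, xb`
together at least five in both directions, then, without rainbow transitive triangle, at most six
edges join `x` to `a, b, c`. -/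
theorem size_le_six_of_cyclic : ∀ p : ColorSet, 2 ≤ size p →
    ∀ s s' : ColorSet, Disj s s' → 2 ≤ size s + size s' →
    ∀ t : ColorSet, Rainbow s p t = false → Rainbow s' t p = false →
    ∀ t' : ColorSet, Rainbow p t' s' = false → Disj t t' →
    5 ≤ size s + size s' + size t + size t' →
    ∀ q r : ColorSet, 8 ≤ size p + size q + size r →
    ∀ u : ColorSet, Rainbow t q u = false → Rainbow t' u q = false → Rainbow u r s = false →
    ∀ u' : ColorSet, Rainbow q u' t' = false → Rainbow r s' u' = false →
    Rainbow u' s r = false → Disj u u' →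
    size s + size s' + size t + size t' + size u + size u' ≤ 6 := by
  decide +kernel

variable {V : Type*} {C : V → V → ColorSet}

/-- In an oriented three-colored family without rainbow transitive triangle, a vertex sends at
most six edges to a triple of vertices spanning at least eight. -/
theorem size_to_triangle_le_six (hC : ∀ u v, Disj (C u v) (C v u))
    (hR : ∀ u v w, Rainbow (C u v) (C v w) (C u w) = false) (a b c x : V)
    (h : 8 ≤ (size (C a b) + size (C b a)) + (size (C b c) + size (C c b)) +
      (size (C c a) + size (C a c))) :
    (size (C x a) + size (C a x)) + (size (C x b) + size (C b x)) +
      (size (C x c) + size (C c x)) ≤ 6 := by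
  have d := fun u v => size_add_size_le (hC u v)
  by_contra! hx
  have key : ∀ a b c : V, 8 ≤ size (C a b) + size (C b c) + size (C c a) →
      7 ≤ (size (C x a) + size (C a x)) + (size (C x b) + size (C b x)) +
        (size (C x c) + size (C c x)) →
      (size (C x a) + size (C a x)) + (size (C x b) + size (C b x)) < 5 := by
    intro a b c h hx
    by_contra! h5
    have := d a b
    have := d b c
    have := d c a
    have := d x b
    have := size_le_six_of_cyclic (C a b) (by omega) _ _ (hC x a) (by omega) (C x b)
      (hR _ _ _) (hR _ _ _) (C b x) (hR _ _ _) (hC x b) (by omega) (C b c) (C c a) h (C x c)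
      (hR _ _ _) (hR _ _ _) (hR _ _ _) (C c x) (hR _ _ _) (hR _ _ _) (hR _ _ _) (hC x c)
    omega
  have absurd_of_cyclic : ∀ a b c : V, 8 ≤ size (C a b) + size (C b c) + size (C c a) →
      7 ≤ (size (C x a) + size (C a x)) + (size (C x b) + size (C b x)) +
        (size (C x c) + size (C c x)) → False := by
    intro a b c h hx
    have := key a b c h hx
    have := key b c a (by omega) (by omega)
    have := key c a b (by omega) (by omega)
    omega
  have := d a b
  have := d b c
  have := d c a
  rcases cyclic_of_eight_le_size _ _ (hC a b) (by omega) _ _ (hC b c) (by omega) (C c a)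
    (hR _ _ _) (hR _ _ _) (C a c) (hR _ _ _) (hR _ _ _) (hR _ _ _) (hR _ _ _) (hC c a)
    (by omega) with h0 | h0
  · exact absurd_of_cyclic a b c (by omega) (by omega)
  · exact absurd_of_cyclic a c b (by omega) (by omega)

end ColorSet

section Weights

open Finset

variable {V : Type*} [DecidableEq V] {d : V → V → ℕ}

/-- Splitting off a subset `T` which sends weight at most `2 * #T` to every other vertex. -/
theorem sum_weight_le_of_sdiff (hsymm : ∀ u v, d u v = d v u) {S T : Finset V} (hT : T ⊆ S)
    (hTT : ∑ u ∈ T, ∑ v ∈ T, d u v ≤ 2 * #T ^ 2)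
    (hx : ∀ x ∈ S \ T, ∑ t ∈ T, d x t ≤ 2 * #T)
    (hS : ∑ u ∈ S \ T, ∑ v ∈ S \ T, d u v ≤ 2 * #(S \ T) ^ 2) :
    ∑ u ∈ S, ∑ v ∈ S, d u v ≤ 2 * #S ^ 2 := by
  have hcross : ∑ x ∈ S \ T, ∑ t ∈ T, d x t ≤ #(S \ T) * (2 * #T) := by
    simpa using sum_le_card_nsmul _ _ _ hx
  have hcross' : ∑ t ∈ T, ∑ x ∈ S \ T, d t x = ∑ x ∈ S \ T, ∑ t ∈ T, d x t := by
    rw [sum_comm]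
    exact sum_congr rfl fun x _ => sum_congr rfl fun t _ => hsymm t x
  have hcard := card_sdiff_add_card_eq_card hT
  have hsplit : ∑ u ∈ S, ∑ v ∈ S, d u v =
      (∑ u ∈ S \ T, ∑ v ∈ S \ T, d u v + ∑ x ∈ S \ T, ∑ t ∈ T, d x t) +
      (∑ t ∈ T, ∑ x ∈ S \ T, d t x + ∑ u ∈ T, ∑ v ∈ T, d u v) := by
    simp only [← sum_add_distrib, sum_sdiff hT]
  rw [hsplit, hcross', ← hcard]
  nlinarith

theorem sum_weight_le (hsymm : ∀ u v, d u v = d v u) (hself : ∀ u, d u u = 0)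
    (hle : ∀ u v, d u v ≤ 3)
    (htri : ∀ a b c x, 8 ≤ d a b + d b c + d c a → d x a + d x b + d x c ≤ 6) (S : Finset V) :
    ∑ u ∈ S, ∑ v ∈ S, d u v ≤ 2 * #S ^ 2 := by
  induction S using Finset.strongInduction with
  | H S ih =>
    by_cases h8 : ∃ a ∈ S, ∃ b ∈ S, ∃ c ∈ S, 8 ≤ d a b + d b c + d c a
    · obtain ⟨a, ha, b, hb, c, hc, h⟩ := h8
      have h1 := hle a b
      have h2 := hle b c
      have h3 := hle c a
      have hab : a ≠ b := by rintro rfl; have := hself a; omega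
      have hbc : b ≠ c := by rintro rfl; have := hself b; omega
      have hac : a ≠ c := by rintro rfl; have := hself a; omega
      have hT : ({a, b, c} : Finset V) ⊆ S := by simp [insert_subset_iff, ha, hb, hc]
      have hcard : #({a, b, c} : Finset V) = 3 := card_eq_three.2 ⟨a, b, c, hab, hac, hbc, rfl⟩
      have hsum : ∀ f : V → ℕ, ∑ v ∈ ({a, b, c} : Finset V), f v = f a + f b + f c := by
        intro f
        rw [sum_insert (by simp [hab, hac]), sum_pair hbc, add_assoc]
      refine sum_weight_le_of_sdiff hsymm hT ?_ ?_ (ih _ (sdiff_ssubset hT ⟨a, by simp⟩))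
      · have := hsymm a b
        have := hsymm b c
        have := hsymm c a
        simp only [hsum, hcard, hself]
        omega
      · intro x _
        rw [hsum, hcard]
        exact htri a b c x h
    push Not at h8
    by_cases h3 : ∃ a ∈ S, ∃ b ∈ S, 3 ≤ d a b
    · obtain ⟨a, ha, b, hb, h⟩ := h3
      have h1 := hle a b
      have hab : a ≠ b := by rintro rfl; have := hself a; omega
      have hT : ({a, b} : Finset V) ⊆ S := by simp [insert_subset_iff, ha, hb]
      refine sum_weight_le_of_sdiff hsymm hT ?_ ?_ (ih _ (sdiff_ssubset hT ⟨a, by simp⟩))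
      · have := hsymm a b
        simp only [sum_pair hab, card_pair hab, hself]
        omega
      · intro x hx
        rw [sum_pair hab, card_pair hab]
        have := h8 a ha b hb x (mem_sdiff.1 hx).1
        have := hsymm b x
        omega
    · push Not at h3
      calc ∑ u ∈ S, ∑ v ∈ S, d u v ≤ ∑ u ∈ S, ∑ v ∈ S, 2 :=
            sum_le_sum fun u hu => sum_le_sum fun v hv => Nat.le_of_lt_succ (h3 u hu v hv)
        _ = 2 * #S ^ 2 := by simp; ring

end Weights

open Finset in
/-- Three oriented graphs without rainbow transitive triangle have at most `n ^ 2` edges. -/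
theorem card_add_card_add_card_le_of_no_rainbow {V : Type*} [Fintype V] [DecidableEq V]
    (A B D : Finset (V × V)) (hA : ∀ u v, (u, v) ∈ A → (v, u) ∉ A)
    (hB : ∀ u v, (u, v) ∈ B → (v, u) ∉ B) (hD : ∀ u v, (u, v) ∈ D → (v, u) ∉ D)
    (hR : ∀ u v w, ColorSet.Rainbow
      (decide ((u, v) ∈ A), decide ((u, v) ∈ B), decide ((u, v) ∈ D))
      (decide ((v, w) ∈ A), decide ((v, w) ∈ B), decide ((v, w) ∈ D))
      (decide ((u, w) ∈ A), decide ((u, w) ∈ B), decide ((u, w) ∈ D)) = false) :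
    #A + #B + #D ≤ Fintype.card V ^ 2 := by
  let C : V → V → ColorSet := fun u v =>
    (decide ((u, v) ∈ A), decide ((u, v) ∈ B), decide ((u, v) ∈ D))
  have hC : ∀ u v, ColorSet.Disj (C u v) (C v u) := by
    intro u v
    simpa [C, ColorSet.Disj, imp_iff_not_or, and_assoc] using
      And.intro (hA u v) (And.intro (hB u v) (hD u v))
  have hself : ∀ u, ColorSet.size (C u u) = 0 := by
    intro u
    have h1 := fun h => hA u u h h
    have h2 := fun h => hB u u h h
    have h3 := fun h => hD u u h h
    simpa [C, ColorSet.size, and_assoc] using And.intro h1 (And.intro h2 h3)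
  have hmain := sum_weight_le (d := fun u v => ColorSet.size (C u v) + ColorSet.size (C v u))
    (fun u v => add_comm _ _) (fun u => by simp [hself])
    (fun u v => ColorSet.size_add_size_le (hC u v))
    (ColorSet.size_to_triangle_le_six hC hR) univ
  have hcard : ∀ X : Finset (V × V), ∑ u, ∑ v, (decide ((u, v) ∈ X)).toNat = #X := by
    intro X
    rw [← Fintype.sum_prod_type' (f := fun u v => (decide ((u, v) ∈ X)).toNat)]
    simp [Bool.toNat, Bool.cond_decide]
  have hsize : ∑ u, ∑ v, ColorSet.size (C u v) = #A + #B + #D := by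
    simp only [C, ColorSet.size, sum_add_distrib, hcard]
  have hsize' : ∑ u, ∑ v, ColorSet.size (C v u) = #A + #B + #D := by
    rw [sum_comm, hsize]
  simp only [sum_add_distrib, hsize, hsize', card_univ] at hmain
  omega

/-- If `c ≥ 3` oriented graphs on a common set of `n` vertices have in total more
than `(c/3)n^2` edges, then there is a rainbow transitive triangle. -/
theorem rainbow_transitive_triangle_oriented_total_edges
    (n c : ℕ) (hc : 3 ≤ c) (G : Fin c → Finset (Fin n × Fin n))
    (hloop : ∀ i : Fin c, ∀ e ∈ G i, e.1 ≠ e.2)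
    (horiented : ∀ i : Fin c, ∀ u v : Fin n, (u, v) ∈ G i → (v, u) ∉ G i)
    (hE : (∑ i : Fin c, ((G i).card : ℝ)) > ((c : ℝ) / 3) * (n : ℝ) ^ 2) :
    ∃ u v w : Fin n, ∃ i j k : Fin c,
      u ≠ v ∧ v ≠ w ∧ u ≠ w ∧ i ≠ j ∧ j ≠ k ∧ i ≠ k ∧
      (u, v) ∈ G i ∧ (v, w) ∈ G j ∧ (u, w) ∈ G k := by
  by_contra hno
  have hfree : ∀ i j k : Fin c, i ≠ j → j ≠ k → i ≠ k → ∀ u v w,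
      (u, v) ∈ G i → (v, w) ∈ G j → (u, w) ∉ G k := fun i j k hij hjk hik u v w h1 h2 h3 =>
    hno ⟨u, v, w, i, j, k, hloop i _ h1, hloop j _ h2, hloop k _ h3, hij, hjk, hik, h1, h2, h3⟩
  have hthree : ∀ i j k : Fin c, i ≠ j → j ≠ k → i ≠ k →
      (G i).card + (G j).card + (G k).card ≤ n ^ 2 := by
    intro i j k hij hjk hik
    refine (card_add_card_add_card_le_of_no_rainbow _ _ _ (horiented i) (horiented j)
      (horiented k) fun u v w => ?_).trans_eq (by rw [Fintype.card_fin])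
    have h1 := hfree i j k hij hjk hik u v w
    have h2 := hfree i k j hik hjk.symm hij u v w
    have h3 := hfree j i k hij.symm hik hjk u v w
    have h4 := hfree j k i hjk hik.symm hij.symm u v w
    have h5 := hfree k i j hik.symm hij hjk.symm u v w
    have h6 := hfree k j i hjk.symm hij.symm hik.symm u v w
    simp only [ColorSet.Rainbow]
    grind
  have : NeZero c := ⟨by omega⟩
  let one : Fin c := ⟨1, by omega⟩
  let two : Fin c := ⟨2, by omega⟩
  have hone : one ≠ 0 := by simp [one, Fin.ext_iff]
  have htwo : two ≠ 0 := by simp [two, Fin.ext_iff]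
  have hne : one ≠ two := by simp [one, two, Fin.ext_iff]
  have hshift : ∀ t : Fin c, ∑ i, ((G (i + t)).card : ℝ) = ∑ i, ((G i).card : ℝ) := fun t =>
    Equiv.sum_comp (Equiv.addRight t) fun i => ((G i).card : ℝ)
  have hsum : ∑ i : Fin c, (((G i).card : ℝ) + (G (i + one)).card + (G (i + two)).card) ≤
      ∑ _i : Fin c, (n : ℝ) ^ 2 := by
    refine Finset.sum_le_sum fun i _ => ?_
    exact_mod_cast hthree i (i + one) (i + two) (by simpa using hone) (by simpa using hne)
      (by simpa using htwo)
  simp only [Finset.sum_add_distrib, hshift, Finset.sum_const, Finset.card_univ, Fintype.card_fin,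
    nsmul_eq_mul] at hsum
  linarith
end

section
/- Let A and B be disjoint finite sets of vertices and let H be a simple undirected graph on the vertex set A ∪ B which does not contain any triangle having at least one vertex in A and at least one vertex in B. Then e(H) ≤ C(|A|,2) + C(|B|,2) + |A|, where C(m,2) denotes the binomial coefficient m choose 2 and e(H) is the number of edges of H. -/
open Finset in
/-- Counting ordered adjacent pairs inside a vertex set: at most `s * (s - 1)`. -/
theorem SimpleGraph.sum_adj_add_card_le_sq {V : Type*} [DecidableEq V] (H : SimpleGraph V)
    [DecidableRel H.Adj] (S : Finset V) :
    (∑ x ∈ S, ∑ y ∈ S, if H.Adj x y then 1 else 0) + S.card ≤ S.card ^ 2 := by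
  have row : ∀ x ∈ S, (∑ y ∈ S, if H.Adj x y then 1 else 0) + 1 ≤ S.card := by
    intro x hx
    rw [← card_filter, Nat.succ_le_iff]
    exact card_lt_card (filter_ssubset.2 ⟨x, hx, H.loopless.irrefl x⟩)
  calc (∑ x ∈ S, ∑ y ∈ S, if H.Adj x y then 1 else 0) + S.card
      = ∑ x ∈ S, ((∑ y ∈ S, if H.Adj x y then 1 else 0) + 1) := by
        rw [sum_add_distrib, card_eq_sum_ones]
    _ ≤ ∑ _x ∈ S, S.card := sum_le_sum row
    _ = S.card ^ 2 := by rw [sum_const, smul_eq_mul, sq]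

open Finset in
/-- Adding two vertices without common neighbours in `T` adds at most `2 * (|T| + 1)` ordered
adjacent pairs. -/
theorem SimpleGraph.sum_adj_insert_insert_le {V : Type*} [DecidableEq V] (H : SimpleGraph V)
    [DecidableRel H.Adj] {T : Finset V} {x y : V} (hxy : x ≠ y) (hx : x ∉ T) (hy : y ∉ T)
    (h : ∀ z ∈ T, ¬ (H.Adj x z ∧ H.Adj y z)) :
    (∑ u ∈ insert x (insert y T), ∑ v ∈ insert x (insert y T), if H.Adj u v then 1 else 0) ≤
      (∑ u ∈ T, ∑ v ∈ T, if H.Adj u v then 1 else 0) + 2 * (T.card + 1) := by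
  have hx' : x ∉ insert y T := by simp [hxy, hx]
  have symm_sum : ∀ u, (∑ v ∈ T, if H.Adj v u then 1 else 0) =
      ∑ v ∈ T, if H.Adj u v then 1 else 0 := fun u => by simp only [H.adj_comm]
  have key : (∑ z ∈ T, if H.Adj x z then 1 else 0) + (∑ z ∈ T, if H.Adj y z then 1 else 0)
      ≤ T.card := by
    rw [← sum_add_distrib, card_eq_sum_ones]
    refine sum_le_sum fun z hz => ?_
    have := h z hz
    split_ifs <;> simp_all
  have hxy1 : (if H.Adj x y then 1 else 0) ≤ 1 := by split_ifs <;> simp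
  have hyx1 : (if H.Adj y x then 1 else 0) ≤ 1 := by split_ifs <;> simp
  simp only [sum_insert hx', sum_insert hy, sum_add_distrib, symm_sum, SimpleGraph.irrefl,
    if_false]
  omega

open Finset in
/-- The bound on ordered adjacent pairs, by induction: remove both ends of an edge between
`A` and `B`. -/
theorem SimpleGraph.sum_adj_union_add_card_le {V : Type*} [DecidableEq V] (H : SimpleGraph V)
    [DecidableRel H.Adj] (A B : Finset V) (hdisj : Disjoint A B)
    (htri : ∀ x ∈ A, ∀ y ∈ B, H.Adj x y → ∀ z, ¬ (H.Adj x z ∧ H.Adj y z)) :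
    (∑ x ∈ A ∪ B, ∑ y ∈ A ∪ B, if H.Adj x y then 1 else 0) + B.card ≤
      A.card ^ 2 + A.card + B.card ^ 2 := by
  induction hn : A.card generalizing A B with
  | zero =>
    obtain rfl := card_eq_zero.1 hn
    simpa using H.sum_adj_add_card_le_sq B
  | succ n ih =>
    by_cases hcross : ∃ x ∈ A, ∃ y ∈ B, H.Adj x y
    · obtain ⟨x, hx, y, hy, hadj⟩ := hcross
      have hxB : x ∉ B := Finset.disjoint_left.1 hdisj hx
      have hyA : y ∉ A := Finset.disjoint_right.1 hdisj hy
      have hA' : (A.erase x).card = n := by rw [card_erase_of_mem hx, hn]; rfl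
      have hB' : (B.erase y).card + 1 = B.card := card_erase_add_one hy
      have hdisj' : Disjoint (A.erase x) (B.erase y) :=
        hdisj.mono (erase_subset _ _) (erase_subset _ _)
      have hrec := ih (A.erase x) (B.erase y) hdisj'
        (fun u hu v hv => htri u (mem_of_mem_erase hu) v (mem_of_mem_erase hv)) hA'
      have hunion : A ∪ B = insert x (insert y (A.erase x ∪ B.erase y)) := by grind
      have hcard : (A.erase x ∪ B.erase y).card = n + (B.erase y).card := by
        rw [card_union_of_disjoint hdisj', hA']
      have hstep := H.sum_adj_insert_insert_le (T := A.erase x ∪ B.erase y) hadj.ne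
        (by simp [hxB]) (by simp [hyA]) (fun z _ => htri x hx y hy hadj z)
      rw [← hunion, hcard] at hstep
      rw [← hB']
      nlinarith
    · push Not at hcross
      have hAB : ∀ x ∈ A, (∑ y ∈ B, if H.Adj x y then 1 else 0) = 0 := fun x hx =>
        sum_eq_zero fun y hy => if_neg (hcross x hx y hy)
      have hBA : ∀ y ∈ B, (∑ x ∈ A, if H.Adj y x then 1 else 0) = 0 := fun y hy =>
        sum_eq_zero fun x hx => if_neg fun hadj => hcross x hx y hy hadj.symm
      have hA := H.sum_adj_add_card_le_sq A
      have hB := H.sum_adj_add_card_le_sq B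
      simp only [sum_union hdisj, sum_add_distrib, sum_eq_zero hAB, sum_eq_zero hBA]
      rw [hn] at hA
      omega

/-- If a simple graph `H` on the disjoint union of vertex sets `A` and `B`
contains no triangle with a vertex in `A` and a vertex in `B`, then
`e(H) ≤ C(|A|,2) + C(|B|,2) + |A|`. -/
theorem bipartite_mantel_bound {V : Type*} [Fintype V] [DecidableEq V]
    (A B : Finset V) (hdisj : Disjoint A B) (hcover : A ∪ B = Finset.univ)
    (H : SimpleGraph V) [DecidableRel H.Adj]
    (htri : ¬ ∃ x y z : V, H.Adj x y ∧ H.Adj y z ∧ H.Adj x z ∧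
        (x ∈ A ∨ y ∈ A ∨ z ∈ A) ∧ (x ∈ B ∨ y ∈ B ∨ z ∈ B)) :
    H.edgeFinset.card ≤ A.card.choose 2 + B.card.choose 2 + A.card := by
  have hpairs := H.sum_adj_union_add_card_le A B hdisj fun x hx y hy hxy z hz =>
    htri ⟨x, y, z, hxy, hz.2, hz.1, Or.inl hx, Or.inr (Or.inl hy)⟩
  have hdeg : (∑ x ∈ A ∪ B, ∑ y ∈ A ∪ B, if H.Adj x y then 1 else 0) =
      2 * H.edgeFinset.card := by
    rw [hcover, ← H.sum_degrees_eq_twice_card_edges]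
    refine Finset.sum_congr rfl fun x _ => ?_
    rw [← Finset.card_filter, ← H.card_neighborFinset_eq_degree, H.neighborFinset_eq_filter]
  have two_choose : ∀ n : ℕ, 2 * n.choose 2 + n = n ^ 2 := fun n => by
    rw [Nat.choose_two_right, Nat.mul_div_cancel' (Nat.even_mul_pred_self n).two_dvd]
    cases n with
    | zero => rfl
    | succ m => rw [Nat.add_sub_cancel]; ring
  have hA := two_choose A.card
  have hB := two_choose B.card
  omega
end

section
/- Let G_1, G_2, G_3 be three directed graphs on a common set of vertices containing no rainbow directed triangle. Let {i,j,k} = {1,2,3} and let u, v, w be three distinct vertices. If exactly one of uv, vu is an edge of G_k (i.e., e_k(u,v) = 1), then e_i(w,{u,v}) + e_j(w,{u,v}) ≤ 6, i.e., the total number of edges of G_i and G_j between w and u together with those between w and v is at most 6. -/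
/-- In three directed graphs with no rainbow directed triangle, if `{i,j,k}`
are the three colors and `u,v,w` are distinct vertices with exactly one edge between `u` and
`v` in color `k`, then the number of edges in colors `i` and `j` between `w` and `{u,v}` is
at most `6`. -/
theorem single_edge_bound {V : Type*} [DecidableEq V]
    (G : Fin 3 → Finset (V × V))
    (hloop : ∀ i : Fin 3, ∀ e ∈ G i, e.1 ≠ e.2)
    (hrb : ¬ ∃ a b c : V, ∃ i j k : Fin 3,
        a ≠ b ∧ b ≠ c ∧ a ≠ c ∧ i ≠ j ∧ j ≠ k ∧ i ≠ k ∧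
        (a, b) ∈ G i ∧ (b, c) ∈ G j ∧ (c, a) ∈ G k)
    (i j k : Fin 3) (hij : i ≠ j) (hjk : j ≠ k) (hik : i ≠ k)
    (u v w : V) (huv : u ≠ v) (hvw : v ≠ w) (huw : u ≠ w)
    (hk : ((if (u, v) ∈ G k then 1 else 0) + (if (v, u) ∈ G k then 1 else 0) : ℕ) = 1) :
    ((if (w, u) ∈ G i then 1 else 0) + (if (u, w) ∈ G i then 1 else 0)
      + ((if (w, v) ∈ G i then 1 else 0) + (if (v, w) ∈ G i then 1 else 0))
      + ((if (w, u) ∈ G j then 1 else 0) + (if (u, w) ∈ G j then 1 else 0))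
      + ((if (w, v) ∈ G j then 1 else 0) + (if (v, w) ∈ G j then 1 else 0)) : ℕ) ≤ 6 := by
  have not_rainbow : ∀ {a b c : V} {p q r : Fin 3}, a ≠ b → b ≠ c → a ≠ c →
      p ≠ q → q ≠ r → p ≠ r → (a, b) ∈ G p → ¬ ((b, c) ∈ G q ∧ (c, a) ∈ G r) :=
    fun hab hbc hac hpq hqr hpr h₁ h₂ =>
      hrb ⟨_, _, _, _, _, _, hab, hbc, hac, hpq, hqr, hpr, h₁, h₂.1, h₂.2⟩
  have h_edge : (u, v) ∈ G k ∨ (v, u) ∈ G k := by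
    by_contra! h
    simp [h.1, h.2] at hk
  rcases h_edge with h | h
  · have h₁ := not_rainbow huv hvw huw hik.symm hij hjk.symm h
    have h₂ := not_rainbow huv hvw huw hjk.symm hij.symm hik.symm h
    clear hk
    split_ifs <;> first | omega | tauto
  · have h₁ := not_rainbow huv.symm huw hvw hik.symm hij hjk.symm h
    have h₂ := not_rainbow huv.symm huw hvw hjk.symm hij.symm hik.symm h
    clear hk
    split_ifs <;> first | omega | tauto
end

section
/- Let G_1, G_2, G_3 be three directed graphs on a common set of vertices containing no rainbow directed triangle. Let {i,j,k} = {1,2,3} and let u, v, w be three distinct vertices. If both uv and vu are edges of G_k (i.e., e_k(u,v) = 2), then e_i(w,{u,v}) + e_j(w,{u,v}) ≤ 4, i.e., the total number of edges of G_i and G_j between w and u together with those between w and v is at most 4. -/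
/-- The indicators of two incompatible propositions sum to at most one. -/
theorem ite_add_ite_le_one_of_not_and {p q : Prop} [Decidable p] [Decidable q]
    (h : ¬ (p ∧ q)) : ((if p then 1 else 0) + (if q then 1 else 0) : ℕ) ≤ 1 := by
  split_ifs <;> simp_all


/-- In three directed graphs with no rainbow directed triangle, if `{i,j,k}`
are the three colors and `u,v,w` are distinct vertices with a double edge between `u` and
`v` in color `k`, then the number of edges in colors `i` and `j` between `w` and `{u,v}` is
at most `4`. -/
theorem double_edge_bound {V : Type*} [DecidableEq V]
    (G : Fin 3 → Finset (V × V))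
    (hloop : ∀ i : Fin 3, ∀ e ∈ G i, e.1 ≠ e.2)
    (hrb : ¬ ∃ a b c : V, ∃ i j k : Fin 3,
        a ≠ b ∧ b ≠ c ∧ a ≠ c ∧ i ≠ j ∧ j ≠ k ∧ i ≠ k ∧
        (a, b) ∈ G i ∧ (b, c) ∈ G j ∧ (c, a) ∈ G k)
    (i j k : Fin 3) (hij : i ≠ j) (hjk : j ≠ k) (hik : i ≠ k)
    (u v w : V) (huv : u ≠ v) (hvw : v ≠ w) (huw : u ≠ w)
    (hk : (u, v) ∈ G k ∧ (v, u) ∈ G k) :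
    ((if (w, u) ∈ G i then 1 else 0) + (if (u, w) ∈ G i then 1 else 0)
      + ((if (w, v) ∈ G i then 1 else 0) + (if (v, w) ∈ G i then 1 else 0))
      + ((if (w, u) ∈ G j then 1 else 0) + (if (u, w) ∈ G j then 1 else 0))
      + ((if (w, v) ∈ G j then 1 else 0) + (if (v, w) ∈ G j then 1 else 0)) : ℕ) ≤ 4 := by
  have hu : ∀ a b, a ≠ b → a ≠ k → b ≠ k → ¬ ((v, w) ∈ G a ∧ (w, u) ∈ G b) :=
    fun a b hab ha hb h =>
      hrb ⟨u, v, w, k, a, b, huv, hvw, huw, ha.symm, hab, hb.symm, hk.1, h.1, h.2⟩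
  have hv : ∀ a b, a ≠ b → a ≠ k → b ≠ k → ¬ ((u, w) ∈ G a ∧ (w, v) ∈ G b) :=
    fun a b hab ha hb h =>
      hrb ⟨v, u, w, k, a, b, huv.symm, huw, hvw, ha.symm, hab, hb.symm, hk.2, h.1, h.2⟩
  have h₁ := ite_add_ite_le_one_of_not_and (hu i j hij hik hjk)
  have h₂ := ite_add_ite_le_one_of_not_and (hu j i hij.symm hjk hik)
  have h₃ := ite_add_ite_le_one_of_not_and (hv i j hij hik hjk)
  have h₄ := ite_add_ite_le_one_of_not_and (hv j i hij.symm hjk hik)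
  linarith
end

section
/- Let G_1, G_2, ..., G_c be c ≥ 4 directed graphs on a common set of vertices containing no rainbow directed triangle, and let u, v, w be three distinct vertices. Suppose that e(u,v) = c+1 with at least 3 colors i satisfying uv ∈ E(G_i), and that e(u,w) = c+1 with at least 3 colors i satisfying uw ∈ E(G_i) (or, symmetrically, e(v,u) = c+1 with at least 3 colors i satisfying vu ∈ E(G_i) and e(w,u) = c+1 with at least 3 colors i satisfying wu ∈ E(G_i)). Then e(v,w) ≤ 2, i.e., the total number of edges between v and w over all c colors is at most 2. -/
theorem Finset.exists_distinct_mem_of_three_le_card {α : Type*} [DecidableEq α]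
    {P Q R : Finset α} (hP : 3 ≤ P.card) (hQ : Q.Nonempty) (hR : 2 ≤ R.card) :
    ∃ p ∈ P, ∃ q ∈ Q, ∃ r ∈ R, p ≠ q ∧ p ≠ r ∧ q ≠ r := by
  obtain ⟨q, hq⟩ := hQ
  obtain ⟨r, hr, hrq⟩ := Finset.exists_mem_ne hR q
  obtain ⟨p, hp, hpqr⟩ := Finset.exists_mem_notMem_of_card_lt_card
    (s := {q, r}) (t := P) (Finset.card_le_two.trans_lt hP)
  simp only [Finset.mem_insert, Finset.mem_singleton, not_or] at hpqr
  exact ⟨p, hp, q, hq, r, hr, hpqr.1, hpqr.2, hrq.symm⟩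

/-- The set of colors in which `xy` is an edge. -/
def edgeColors {V : Type*} [DecidableEq V] {c : ℕ} (G : Fin c → Finset (V × V)) (x y : V) :
    Finset (Fin c) :=
  Finset.univ.filter fun i => (x, y) ∈ G i

section edgeColors

variable {V : Type*} [DecidableEq V] {c : ℕ} {G : Fin c → Finset (V × V)}

theorem mem_edgeColors {x y : V} {i : Fin c} : i ∈ edgeColors G x y ↔ (x, y) ∈ G i := by
  simp [edgeColors]

theorem sum_edges_eq_card_add_card (x y : V) :
    (∑ i : Fin c, ((if (x, y) ∈ G i then 1 else 0) + (if (y, x) ∈ G i then 1 else 0) : ℕ)) =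
      (edgeColors G x y).card + (edgeColors G y x).card := by
  simp only [edgeColors, Finset.sum_add_distrib, Finset.card_filter]

theorem edgeColors_nonempty_of_card_add_card {x y z t : V}
    (h : (edgeColors G x y).card + (edgeColors G z t).card = c + 1) :
    (edgeColors G x y).Nonempty := by
  have := card_finset_fin_le (edgeColors G z t)
  exact Finset.card_pos.mp (by omega)

/-- Without rainbow directed triangles, if one of `xy`, `yz` has at least three colors
and the other at least one, then `zx` has at most one. -/
theorem card_edgeColors_le_one
    (hrb : ¬ ∃ a b d : V, ∃ i j k : Fin c,
        a ≠ b ∧ b ≠ d ∧ a ≠ d ∧ i ≠ j ∧ j ≠ k ∧ i ≠ k ∧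
        (a, b) ∈ G i ∧ (b, d) ∈ G j ∧ (d, a) ∈ G k)
    {x y z : V} (hxy : x ≠ y) (hyz : y ≠ z) (hxz : x ≠ z)
    (h : (3 ≤ (edgeColors G x y).card ∧ (edgeColors G y z).Nonempty) ∨
      ((edgeColors G x y).Nonempty ∧ 3 ≤ (edgeColors G y z).card)) :
    (edgeColors G z x).card ≤ 1 := by
  by_contra! hzx
  rcases h with ⟨h₁, h₂⟩ | ⟨h₁, h₂⟩
  · obtain ⟨i, hi, j, hj, k, hk, hij, hik, hjk⟩ :=
      Finset.exists_distinct_mem_of_three_le_card h₁ h₂ hzx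
    exact hrb ⟨x, y, z, i, j, k, hxy, hyz, hxz, hij, hjk, hik,
      mem_edgeColors.mp hi, mem_edgeColors.mp hj, mem_edgeColors.mp hk⟩
  · obtain ⟨j, hj, i, hi, k, hk, hji, hjk, hik⟩ :=
      Finset.exists_distinct_mem_of_three_le_card h₂ h₁ hzx
    exact hrb ⟨x, y, z, i, j, k, hxy, hyz, hxz, hji.symm, hjk, hik,
      mem_edgeColors.mp hi, mem_edgeColors.mp hj, mem_edgeColors.mp hk⟩

end edgeColors

/-- In `c ≥ 4` directed graphs with no rainbow directed triangle, if distinct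
vertices `u,v,w` satisfy `e(u,v) = c+1` with at least 3 colors having the edge `uv` and
`e(u,w) = c+1` with at least 3 colors having the edge `uw` (or the symmetric condition with
all these edges reversed), then `e(v,w) ≤ 2`. -/
theorem out_edges_bound {V : Type*} [DecidableEq V]
    (c : ℕ) (hc : 4 ≤ c) (G : Fin c → Finset (V × V))
    (hloop : ∀ i : Fin c, ∀ e ∈ G i, e.1 ≠ e.2)
    (hrb : ¬ ∃ a b d : V, ∃ i j k : Fin c,
        a ≠ b ∧ b ≠ d ∧ a ≠ d ∧ i ≠ j ∧ j ≠ k ∧ i ≠ k ∧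
        (a, b) ∈ G i ∧ (b, d) ∈ G j ∧ (d, a) ∈ G k)
    (u v w : V) (huv : u ≠ v) (hvw : v ≠ w) (huw : u ≠ w)
    (h : ((∑ i : Fin c, ((if (u, v) ∈ G i then 1 else 0) + (if (v, u) ∈ G i then 1 else 0) : ℕ))
            = c + 1 ∧
          3 ≤ (Finset.univ.filter (fun i : Fin c => (u, v) ∈ G i)).card ∧
          (∑ i : Fin c, ((if (u, w) ∈ G i then 1 else 0) + (if (w, u) ∈ G i then 1 else 0) : ℕ))
            = c + 1 ∧
          3 ≤ (Finset.univ.filter (fun i : Fin c => (u, w) ∈ G i)).card)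
        ∨
         ((∑ i : Fin c, ((if (u, v) ∈ G i then 1 else 0) + (if (v, u) ∈ G i then 1 else 0) : ℕ))
            = c + 1 ∧
          3 ≤ (Finset.univ.filter (fun i : Fin c => (v, u) ∈ G i)).card ∧
          (∑ i : Fin c, ((if (u, w) ∈ G i then 1 else 0) + (if (w, u) ∈ G i then 1 else 0) : ℕ))
            = c + 1 ∧
          3 ≤ (Finset.univ.filter (fun i : Fin c => (w, u) ∈ G i)).card)) :
    (∑ i : Fin c, ((if (v, w) ∈ G i then 1 else 0) + (if (w, v) ∈ G i then 1 else 0) : ℕ)) ≤ 2 := by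
  simp only [sum_edges_eq_card_add_card] at h ⊢
  rcases h with ⟨huv_sum, huv_card, huw_sum, huw_card⟩ | ⟨huv_sum, hvu_card, huw_sum, hwu_card⟩
  · have hvw_card := card_edgeColors_le_one hrb huw.symm huv hvw.symm
      (.inr ⟨edgeColors_nonempty_of_card_add_card (by rwa [add_comm] at huw_sum), huv_card⟩)
    have hwv_card := card_edgeColors_le_one hrb huv.symm huw hvw
      (.inr ⟨edgeColors_nonempty_of_card_add_card (by rwa [add_comm] at huv_sum), huw_card⟩)
    omega
  · have hvw_card := card_edgeColors_le_one hrb huw.symm huv hvw.symm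
      (.inl ⟨hwu_card, edgeColors_nonempty_of_card_add_card huv_sum⟩)
    have hwv_card := card_edgeColors_le_one hrb huv.symm huw hvw
      (.inl ⟨hvu_card, edgeColors_nonempty_of_card_add_card huw_sum⟩)
    omega
end

section
/- Let G_1, G_2, ..., G_c be c ≥ 3 directed graphs on a common set of vertices containing no rainbow transitive triangle. Suppose that for two distinct colors i, j the vertices u and v are connected with double edges in both colors, i.e., uv, vu ∈ E(G_i) and uv, vu ∈ E(G_j). Then for every vertex x distinct from u and v, if there is at least one edge between x and u in some color, then e(x,v) ≤ 4, i.e., the total number of edges between x and v over all c colors is at most 4. -/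
/-- If `u` and `v` are joined by a double edge of color `k`, then any edge between `x` and `u` of
color `m` and any edge between `x` and `v` of color `l` complete it to a rainbow transitive
triangle, provided that `k`, `l`, `m` are pairwise distinct. -/
theorem exists_rainbow_transitive_triangle {V ι : Type*} (G : ι → Finset (V × V))
    {u v x : V} (huv : u ≠ v) (hxu : x ≠ u) (hxv : x ≠ v)
    {k l m : ι} (hkl : k ≠ l) (hkm : k ≠ m) (hlm : l ≠ m)
    (huvk : (u, v) ∈ G k) (hvuk : (v, u) ∈ G k)
    (hm : (x, u) ∈ G m ∨ (u, x) ∈ G m) (hl : (x, v) ∈ G l ∨ (v, x) ∈ G l) :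
    ∃ a b d : V, ∃ i j k : ι,
      a ≠ b ∧ b ≠ d ∧ a ≠ d ∧ i ≠ j ∧ j ≠ k ∧ i ≠ k ∧
      (a, b) ∈ G i ∧ (b, d) ∈ G j ∧ (a, d) ∈ G k := by
  rcases hm with hm | hm <;> rcases hl with hl | hl
  · exact ⟨x, u, v, m, k, l, hxu, huv, hxv, hkm.symm, hkl, hlm.symm, hm, huvk, hl⟩
  · exact ⟨v, x, u, l, m, k, hxv.symm, hxu, huv.symm, hlm, hkm.symm, hkl.symm, hl, hm, hvuk⟩
  · exact ⟨u, x, v, m, l, k, hxu.symm, hxv, huv, hlm.symm, hkl.symm, hkm.symm, hm, hl, huvk⟩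
  · exact ⟨u, v, x, k, l, m, huv, hxv.symm, hxu.symm, hkl, hlm, hkm, huvk, hl, hm⟩

/-- If all edges between `x` and `v` have colors in `S`, there are at most `2 * #S` of them. -/
theorem sum_edges_le_two_mul_card {V ι : Type*} [DecidableEq V] [Fintype ι]
    (G : ι → Finset (V × V)) (x v : V) (S : Finset ι)
    (hS : ∀ l, (x, v) ∈ G l ∨ (v, x) ∈ G l → l ∈ S) :
    (∑ m : ι, ((if (x, v) ∈ G m then 1 else 0) + (if (v, x) ∈ G m then 1 else 0) : ℕ))
      ≤ 2 * S.card := by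
  rw [← Finset.sum_subset (Finset.subset_univ S), mul_comm, ← smul_eq_mul]
  · refine Finset.sum_le_card_nsmul _ _ _ fun l _ => ?_
    split_ifs <;> simp
  · intro l _ hl
    have h := mt (hS l) hl
    push Not at h
    simp [h.1, h.2]

/-- In `c ≥ 3` directed graphs with no rainbow transitive triangle, if vertices
`u` and `v` are connected by double edges in two distinct colors `i` and `j`, then every
vertex `x ∉ {u,v}` having at least one edge to or from `u` in some color satisfies
`e(x,v) ≤ 4`. -/
theorem double_double_edge_bound {V : Type*} [DecidableEq V]
    (c : ℕ) (hc : 3 ≤ c) (G : Fin c → Finset (V × V))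
    (hloop : ∀ i : Fin c, ∀ e ∈ G i, e.1 ≠ e.2)
    (hrb : ¬ ∃ a b d : V, ∃ i j k : Fin c,
        a ≠ b ∧ b ≠ d ∧ a ≠ d ∧ i ≠ j ∧ j ≠ k ∧ i ≠ k ∧
        (a, b) ∈ G i ∧ (b, d) ∈ G j ∧ (a, d) ∈ G k)
    (i j : Fin c) (hij : i ≠ j) (u v : V) (huv : u ≠ v)
    (hdi : (u, v) ∈ G i ∧ (v, u) ∈ G i) (hdj : (u, v) ∈ G j ∧ (v, u) ∈ G j)
    (x : V) (hxu : x ≠ u) (hxv : x ≠ v)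
    (hedge : ∃ m : Fin c, (x, u) ∈ G m ∨ (u, x) ∈ G m) :
    (∑ m : Fin c, ((if (x, v) ∈ G m then 1 else 0) + (if (v, x) ∈ G m then 1 else 0) : ℕ)) ≤ 4 := by
  obtain ⟨m, hm⟩ := hedge
  have key : ∀ k l, (u, v) ∈ G k ∧ (v, u) ∈ G k → (x, v) ∈ G l ∨ (v, x) ∈ G l →
      k = l ∨ k = m ∨ l = m := by
    intro k l hk hl
    by_contra! h
    exact hrb (exists_rainbow_transitive_triangle G huv hxu hxv h.1 h.2.1 h.2.2 hk.1 hk.2 hm hl)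
  by_cases hmij : m = i ∨ m = j
  · refine (sum_edges_le_two_mul_card G x v {i, j} fun l hl => ?_).trans
      (Nat.mul_le_mul_left 2 Finset.card_le_two)
    have h₁ := key i l hdi hl
    have h₂ := key j l hdj hl
    simp only [Finset.mem_insert, Finset.mem_singleton]
    grind
  · refine (sum_edges_le_two_mul_card G x v {m} fun l hl => ?_).trans (by simp)
    have h₁ := key i l hdi hl
    have h₂ := key j l hdj hl
    simp only [Finset.mem_singleton]
    grind
end

section
/- Let G_1, G_2, ..., G_c be c ≥ 3 oriented graphs on a common set of vertices containing no rainbow transitive triangle. Suppose u, v, w are distinct vertices such that there are at least 3 colors i with uv ∈ E(G_i) and at least 3 colors i with vw ∈ E(G_i). Then every vertex x ∉ {u,v,w} satisfies e(x,{u,v,w}) ≤ 2c, i.e., the total number of edges over all c colors between x and the vertices u, v, w is at most 2c. -/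
/-- If no three pairwise distinct elements can be picked one from each of `X`, `Y`, `P`, and `P` has
at least three elements, then one of `X`, `Y` is empty or both are singletons. -/
lemma card_of_no_distinct_representatives {α : Type*} [DecidableEq α] {X Y P : Finset α}
    (hP : 3 ≤ P.card)
    (h : ∀ i ∈ X, ∀ j ∈ Y, ∀ k ∈ P, i ≠ j → j ≠ k → i ≠ k → False) :
    X.card = 0 ∨ Y.card = 0 ∨ (X.card = 1 ∧ Y.card = 1) := by
  have heq : ∀ i ∈ X, ∀ j ∈ Y, i = j := by
    intro i hi j hj
    by_contra hij
    obtain ⟨k, hk, hk'⟩ := Finset.exists_mem_notMem_of_card_lt_card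
      (Finset.card_le_two.trans_lt hP : ({i, j} : Finset α).card < P.card)
    simp only [Finset.mem_insert, Finset.mem_singleton, not_or] at hk'
    exact h i hi j hj k hk hij (Ne.symm hk'.2) (Ne.symm hk'.1)
  rcases X.eq_empty_or_nonempty with rfl | ⟨a, ha⟩
  · simp
  rcases Y.eq_empty_or_nonempty with rfl | ⟨b, hb⟩
  · simp
  refine Or.inr (Or.inr ⟨Finset.card_eq_one.2 ⟨b, ?_⟩, Finset.card_eq_one.2 ⟨a, ?_⟩⟩)
  · exact Finset.eq_singleton_iff_nonempty_unique_mem.2 ⟨⟨a, ha⟩, fun i hi => heq i hi b hb⟩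
  · exact Finset.eq_singleton_iff_nonempty_unique_mem.2
      ⟨⟨b, hb⟩, fun j hj => (heq a ha j hj).symm⟩


/-- In `c ≥ 3` oriented graphs with no rainbow transitive triangle, if distinct
vertices `u,v,w` form a thick path (at least 3 colors with the edge `uv` and at least 3 colors
with the edge `vw`), then every vertex `x ∉ {u,v,w}` satisfies `e(x,{u,v,w}) ≤ 2c`. -/
theorem thick_path_bound {V : Type*} [DecidableEq V]
    (c : ℕ) (hc : 3 ≤ c) (G : Fin c → Finset (V × V))
    (hloop : ∀ i : Fin c, ∀ e ∈ G i, e.1 ≠ e.2)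
    (horiented : ∀ i : Fin c, ∀ a b : V, (a, b) ∈ G i → (b, a) ∉ G i)
    (hrb : ¬ ∃ a b d : V, ∃ i j k : Fin c,
        a ≠ b ∧ b ≠ d ∧ a ≠ d ∧ i ≠ j ∧ j ≠ k ∧ i ≠ k ∧
        (a, b) ∈ G i ∧ (b, d) ∈ G j ∧ (a, d) ∈ G k)
    (u v w : V) (huv : u ≠ v) (hvw : v ≠ w) (huw : u ≠ w)
    (huv3 : 3 ≤ (Finset.univ.filter (fun i : Fin c => (u, v) ∈ G i)).card)
    (hvw3 : 3 ≤ (Finset.univ.filter (fun i : Fin c => (v, w) ∈ G i)).card)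
    (x : V) (hxu : x ≠ u) (hxv : x ≠ v) (hxw : x ≠ w) :
    (∑ m : Fin c,
        (((if (x, u) ∈ G m then 1 else 0) + (if (u, x) ∈ G m then 1 else 0))
          + ((if (x, v) ∈ G m then 1 else 0) + (if (v, x) ∈ G m then 1 else 0))
          + ((if (x, w) ∈ G m then 1 else 0) + (if (w, x) ∈ G m then 1 else 0)) : ℕ))
      ≤ 2 * c := by
  let D (a b : V) : Finset (Fin c) := Finset.univ.filter fun i => (a, b) ∈ G i
  have hD {a b : V} {i : Fin c} : i ∈ D a b ↔ (a, b) ∈ G i := by simp [D]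
  have hpair (a b : V) : (D a b).card + (D b a).card ≤ c := by
    rw [← Finset.card_union_of_disjoint]
    · simpa using Finset.card_le_univ (D a b ∪ D b a)
    · exact Finset.disjoint_left.2 fun i hi hi' => horiented i a b (hD.1 hi) (hD.1 hi')
  have hthick (a b : V) (hab : a ≠ b) (hxa : x ≠ a) (hxb : x ≠ b) (h3 : 3 ≤ (D a b).card) :
      let R (X Y : Finset (Fin c)) := X.card = 0 ∨ Y.card = 0 ∨ (X.card = 1 ∧ Y.card = 1)
      R (D x a) (D x b) ∧ R (D a x) (D x b) ∧ R (D a x) (D b x) := by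
    refine ⟨?_, ?_, ?_⟩ <;> refine card_of_no_distinct_representatives h3 ?_ <;>
      intro i hi j hj k hk hij hjk hik <;> rw [hD] at hi hj hk <;> apply hrb
    · exact ⟨x, a, b, i, k, j, hxa, hab, hxb, hik, hjk.symm, hij, hi, hk, hj⟩
    · exact ⟨a, x, b, i, j, k, hxa.symm, hxb, hab, hij, hjk, hik, hi, hj, hk⟩
    · exact ⟨a, b, x, k, j, i, hab, hxb.symm, hxa.symm, hjk.symm, hij.symm, hik.symm, hk, hj, hi⟩
  have hu := hthick u v huv hxu hxv huv3
  have hw := hthick v w hvw hxv hxw hvw3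
  have hsum (a b : V) : (∑ m : Fin c, if (a, b) ∈ G m then 1 else 0) = (D a b).card := by
    simp [D]
  simp only [Finset.sum_add_distrib, hsum]
  have := hpair x u
  have := hpair x v
  have := hpair x w
  dsimp only at hu hw
  omega
end

section
/- For every even natural number n and every c ≥ 1 there exist directed graphs G_1, G_2, ..., G_c on a common set of n vertices such that e(G_i) = (1/2)n^2 for every i ∈ {1,...,c} and there is no rainbow directed triangle and no rainbow transitive triangle. (Take each G_i to be the directed graph obtained from the complete bipartite graph with parts of size n/2 by replacing every edge by edges directed in both directions.) -/
/-- The bidirected complete bipartite graph with parts `S` and `Sᶜ`. -/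
def bidirectedBipartite {V : Type*} [Fintype V] [DecidableEq V] (S : Finset V) :
    Finset (V × V) :=
  S ×ˢ Sᶜ ∪ Sᶜ ×ˢ S

theorem mem_bidirectedBipartite {V : Type*} [Fintype V] [DecidableEq V] {S : Finset V}
    {u v : V} : (u, v) ∈ bidirectedBipartite S ↔ (u ∈ S ∧ v ∉ S) ∨ (u ∉ S ∧ v ∈ S) := by
  simp [bidirectedBipartite]

theorem card_bidirectedBipartite {V : Type*} [Fintype V] [DecidableEq V] (S : Finset V) :
    (bidirectedBipartite S).card = 2 * (S.card * Sᶜ.card) := by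
  rw [bidirectedBipartite, Finset.card_union_of_disjoint, Finset.card_product,
    Finset.card_product]
  · ring
  · exact Finset.disjoint_product.mpr (Or.inl disjoint_compl_right)

/-- For every even `n` and every `c ≥ 1` there are `c` directed graphs on `n`
common vertices, each with exactly `(1/2)n^2` edges, with no rainbow directed triangle and no
rainbow transitive triangle. -/
theorem exists_extremal_construction_four_colors
    (n c : ℕ) (hn : Even n) (hc : 1 ≤ c) :
    ∃ G : Fin c → Finset (Fin n × Fin n),
      (∀ i : Fin c, ∀ e ∈ G i, e.1 ≠ e.2) ∧
      (∀ i : Fin c, ((G i).card : ℝ) = (1 / 2 : ℝ) * (n : ℝ) ^ 2) ∧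
      ¬ (∃ u v w : Fin n, ∃ i j k : Fin c,
          u ≠ v ∧ v ≠ w ∧ u ≠ w ∧ i ≠ j ∧ j ≠ k ∧ i ≠ k ∧
          (u, v) ∈ G i ∧ (v, w) ∈ G j ∧ (w, u) ∈ G k) ∧
      ¬ (∃ u v w : Fin n, ∃ i j k : Fin c,
          u ≠ v ∧ v ≠ w ∧ u ≠ w ∧ i ≠ j ∧ j ≠ k ∧ i ≠ k ∧
          (u, v) ∈ G i ∧ (v, w) ∈ G j ∧ (u, w) ∈ G k) := by
  obtain ⟨m, rfl⟩ := hn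
  obtain ⟨S, -, hS⟩ := Finset.exists_subset_card_eq
    (s := (Finset.univ : Finset (Fin (m + m)))) (n := m) (by simp)
  have hSc : Sᶜ.card = m := by
    rw [Finset.card_compl, hS, Fintype.card_fin, Nat.add_sub_cancel]
  refine ⟨fun _ => bidirectedBipartite S, ?_, ?_, ?_, ?_⟩
  · rintro _ ⟨u, v⟩ he (rfl : u = v)
    rw [mem_bidirectedBipartite] at he
    tauto
  · intro _
    rw [card_bidirectedBipartite, hS, hSc]
    push_cast
    ring
  all_goals
    rintro ⟨u, v, w, _, _, _, -, -, -, -, -, -, huv, hvw, huw⟩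
    rw [mem_bidirectedBipartite] at huv hvw huw
    tauto
end

section
/- For every natural number n divisible by 3 there exist directed graphs G_1, G_2, G_3 on a common set of n vertices such that e(G_i) = (5/9)n^2 − (2/3)n for every i ∈ {1,2,3} and there is no rainbow directed triangle. (Split the vertex set into three sets A_1, A_2, A_3 of n/3 vertices each; for each i, G_i contains all ordered pairs of distinct vertices inside A_j for each j ≠ i, together with all edges directed from A_1 to A_2, from A_1 to A_3, and from A_2 to A_3.) -/
/-- The `i`-th extremal digraph on the vertex set `Fin 3 × Fin m`, with parts given by the first
coordinate: all forward edges between parts, and all edges inside the parts other than `i`. -/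
def IsExtremalEdge {m : ℕ} (i : Fin 3) (u v : Fin 3 × Fin m) : Prop :=
  u.1 < v.1 ∨ (u.1 = v.1 ∧ u.1 ≠ i ∧ u.2 ≠ v.2)

instance {m : ℕ} (i : Fin 3) (u v : Fin 3 × Fin m) : Decidable (IsExtremalEdge i u v) := by
  unfold IsExtremalEdge
  infer_instance

theorem IsExtremalEdge.ne {m : ℕ} {i : Fin 3} {u v : Fin 3 × Fin m}
    (h : IsExtremalEdge i u v) : u ≠ v := by
  rintro rfl
  simp [IsExtremalEdge] at h

theorem IsExtremalEdge.not_rainbow {m : ℕ} {i j k : Fin 3} {u v w : Fin 3 × Fin m}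
    (hij : i ≠ j) (hjk : j ≠ k) (hik : i ≠ k) (huv : IsExtremalEdge i u v)
    (hvw : IsExtremalEdge j v w) : ¬ IsExtremalEdge k w u := by
  unfold IsExtremalEdge at *
  omega

theorem sum_ne_indicator (m : ℕ) :
    ∑ x : Fin m, ∑ y : Fin m, (if x ≠ y then (1 : ℝ) else 0) = (m : ℝ) ^ 2 - m := by
  have h (x y : Fin m) : (if x ≠ y then (1 : ℝ) else 0) = 1 - if x = y then 1 else 0 := by
    split_ifs <;> simp_all
  simp only [h, Finset.sum_sub_distrib, Finset.sum_ite_eq, Finset.mem_univ, if_true]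
  simp [sq]

theorem sum_isExtremalEdge (m : ℕ) (i : Fin 3) :
    ∑ u : Fin 3 × Fin m, ∑ v : Fin 3 × Fin m, (if IsExtremalEdge i u v then (1 : ℝ) else 0) =
      5 * (m : ℝ) ^ 2 - 2 * m := by
  have h := sum_ne_indicator m
  simp only [IsExtremalEdge, Fintype.sum_prod_type, Fin.sum_univ_three, Finset.sum_add_distrib]
  fin_cases i <;> simp [-Finset.sum_boole, -ite_not] at h ⊢ <;> linarith


/-- For every `n` divisible by `3` there are three directed graphs on `n` common
vertices, each with exactly `(5/9)n^2 - (2/3)n` edges, with no rainbow directed triangle. -/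
theorem exists_extremal_construction_directed_three_colors
    (n : ℕ) (hn : 3 ∣ n) :
    ∃ G : Fin 3 → Finset (Fin n × Fin n),
      (∀ i : Fin 3, ∀ e ∈ G i, e.1 ≠ e.2) ∧
      (∀ i : Fin 3, ((G i).card : ℝ) = (5 / 9 : ℝ) * (n : ℝ) ^ 2 - (2 / 3 : ℝ) * (n : ℝ)) ∧
      ¬ (∃ u v w : Fin n, ∃ i j k : Fin 3,
          u ≠ v ∧ v ≠ w ∧ u ≠ w ∧ i ≠ j ∧ j ≠ k ∧ i ≠ k ∧
          (u, v) ∈ G i ∧ (v, w) ∈ G j ∧ (w, u) ∈ G k) := by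
  obtain ⟨m, rfl⟩ := hn
  let p : Fin (3 * m) ≃ Fin 3 × Fin m := finProdFinEquiv.symm
  refine ⟨fun i => {e | IsExtremalEdge i (p e.1) (p e.2)}, ?_, ?_, ?_⟩
  · intro i e he h
    exact (Finset.mem_filter.mp he).2.ne (congrArg p h)
  · intro i
    rw [Finset.card_filter, Fintype.sum_prod_type]
    push_cast
    have h (u : Fin (3 * m)) := p.sum_comp fun v => if IsExtremalEdge i (p u) v then (1 : ℝ) else 0
    simp only [h]
    rw [p.sum_comp fun u => ∑ v, if IsExtremalEdge i u v then (1 : ℝ) else 0,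
      sum_isExtremalEdge]
    ring
  · rintro ⟨u, v, w, i, j, k, -, -, -, hij, hjk, hik, huv, hvw, hwu⟩
    simp only [Finset.mem_filter, Finset.mem_univ, true_and] at huv hvw hwu
    exact huv.not_rainbow hij hjk hik hvw hwu
end

section
/- For every natural number n divisible by 3 and every c ≥ 1 there exist oriented graphs G_1, G_2, ..., G_c on a common set of n vertices such that e(G_i) = (1/3)n^2 for every i ∈ {1,...,c} and there is no rainbow transitive triangle. (Split the vertex set into three sets A_1, A_2, A_3 of n/3 vertices each and let every G_i consist of all edges directed from A_1 to A_2, from A_2 to A_3, and from A_3 to A_1.) -/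
/-- In `Fin (3 * m)` every residue class modulo `3` has `m` elements. -/
theorem card_filter_fin_modEq_three (m a : ℕ) :
    (Finset.univ.filter fun v : Fin (3 * m) => (v : ℕ) ≡ a [MOD 3]).card = m := by
  have h := Nat.count_modEq_card (3 * m) (by norm_num : 0 < 3) a
  rw [Nat.count_eq_card_filter_range, ← Nat.Iio_eq_range, ← Fin.map_valEmbedding_univ,
    Finset.filter_map, Finset.card_map] at h
  simpa [Function.comp_def] using h

/-- The blow-up of the directed triangle on the residue classes modulo `3`. -/
def cyclicBlowup (n : ℕ) : Finset (Fin n × Fin n) :=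
  Finset.univ.filter fun e => (e.2 : ℕ) ≡ e.1 + 1 [MOD 3]

theorem mem_cyclicBlowup {n : ℕ} {u v : Fin n} :
    (u, v) ∈ cyclicBlowup n ↔ (v : ℕ) ≡ u + 1 [MOD 3] := by
  simp [cyclicBlowup]

theorem card_cyclicBlowup (m : ℕ) : (cyclicBlowup (3 * m)).card = 3 * m * m := by
  have h : (cyclicBlowup (3 * m)).card = ∑ u : Fin (3 * m),
      (Finset.univ.filter fun v : Fin (3 * m) => (v : ℕ) ≡ u + 1 [MOD 3]).card := by
    simp only [cyclicBlowup, Finset.card_filter, Fintype.sum_prod_type]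
  simp [h, card_filter_fin_modEq_three]

/-- For every `n` divisible by `3` and every `c ≥ 1` there are `c` oriented
graphs on `n` common vertices, each with exactly `(1/3)n^2` edges, with no rainbow transitive
triangle. -/
theorem exists_extremal_construction_oriented
    (n c : ℕ) (hn : 3 ∣ n) (hc : 1 ≤ c) :
    ∃ G : Fin c → Finset (Fin n × Fin n),
      (∀ i : Fin c, ∀ e ∈ G i, e.1 ≠ e.2) ∧
      (∀ i : Fin c, ∀ u v : Fin n, (u, v) ∈ G i → (v, u) ∉ G i) ∧
      (∀ i : Fin c, ((G i).card : ℝ) = (1 / 3 : ℝ) * (n : ℝ) ^ 2) ∧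
      ¬ (∃ u v w : Fin n, ∃ i j k : Fin c,
          u ≠ v ∧ v ≠ w ∧ u ≠ w ∧ i ≠ j ∧ j ≠ k ∧ i ≠ k ∧
          (u, v) ∈ G i ∧ (v, w) ∈ G j ∧ (u, w) ∈ G k) := by
  obtain ⟨m, rfl⟩ := hn
  refine ⟨fun _ => cyclicBlowup (3 * m), ?_, ?_, ?_, ?_⟩
  · rintro _ ⟨u, v⟩ h (rfl : u = v)
    rw [mem_cyclicBlowup, Nat.ModEq] at h
    omega
  · intro _ u v h h'
    rw [mem_cyclicBlowup, Nat.ModEq] at h h'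
    omega
  · intro _
    rw [card_cyclicBlowup]
    push_cast
    ring
  · rintro ⟨u, v, w, _, _, _, -, -, -, -, -, -, huv, hvw, huw⟩
    rw [mem_cyclicBlowup, Nat.ModEq] at huv hvw huw
    omega
end
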